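/- Let G be a finite group and σ a partition of the set of all primes. Suppose that for every prime p dividing |G|, every Sylow p-subgroup P of G, and every maximal subgroup V of P, there exists a subgroup T of G with VT = G such that T is a σ-soluble PσT-group. Then G is a σ-soluble PσT-group. -/

import Mathlib

open scoped Pointwise

/-- `σ` is a partition of the set of all primes: each class is nonempty, the
classes are pairwise disjoint, and their union is the set of all primes. -/
def SigmaPartition {ι : Type*} (σ : ι → Set ℕ) : Prop :=
  (∀ i, (σ i).Nonempty) ∧ (Pairwise fun i j => Disjoint (σ i) (σ j)) ∧
    (⋃ i, σ i) = {p : ℕ | p.Prime}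

/-- A group is `σ`-primary if all primes dividing its order lie in a single class `σ i`. -/
def SigmaPrimary {ι : Type*} (σ : ι → Set ℕ) (G : Type*) [Group G] : Prop :=
  ∃ i, ∀ p : ℕ, p.Prime → p ∣ Nat.card G → p ∈ σ i

/-- A group is `σ`-soluble if it has a normal series all of whose factors are
`σ`-primary (the order of the factor `c k.succ / c k.castSucc` is the index
`((c k.castSucc).subgroupOf (c k.succ)).index`). -/
def SigmaSoluble {ι : Type*} (σ : ι → Set ℕ) (G : Type*) [Group G] : Prop :=
  ∃ (n : ℕ) (c : Fin (n + 1) → Subgroup G),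
    c 0 = ⊥ ∧ c (Fin.last n) = ⊤ ∧ Monotone c ∧ (∀ k, (c k).Normal) ∧
    ∀ k : Fin n, ∃ i, ∀ p : ℕ, p.Prime →
      p ∣ ((c k.castSucc).subgroupOf (c k.succ)).index → p ∈ σ i

/-- A group is `σ`-nilpotent if it is the (internal) direct product of finitely many
`σ`-primary (normal) subgroups. -/
def SigmaNilpotent {ι : Type*} (σ : ι → Set ℕ) (G : Type*) [Group G] : Prop :=
  ∃ (n : ℕ) (H : Fin n → Subgroup G),
    (∀ k, (H k).Normal) ∧ iSupIndep H ∧ (⨆ k, H k) = ⊤ ∧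
    ∀ k, ∃ i, ∀ p : ℕ, p.Prime → p ∣ Nat.card (H k) → p ∈ σ i

/-- A Hall `ρ`-subgroup: all primes dividing its order lie in `ρ`, and no prime
dividing its index lies in `ρ`. -/
def IsHallSubgroup {G : Type*} [Group G] (ρ : Set ℕ) (H : Subgroup G) : Prop :=
  (∀ p : ℕ, p.Prime → p ∣ Nat.card H → p ∈ ρ) ∧
  (∀ p : ℕ, p.Prime → p ∣ H.index → p ∉ ρ)

/-- A Hall `σ i`-subgroup of `G`. -/
def IsHallSigmaSubgroup {ι : Type*} (σ : ι → Set ℕ) {G : Type*} [Group G]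
    (i : ι) (H : Subgroup G) : Prop :=
  IsHallSubgroup (σ i) H

/-- A complete Hall `σ`-set of `G`: every nontrivial member is a Hall
`σ i`-subgroup for some `i`, and for every `i` with `σ i ∩ π(G) ≠ ∅` the set
contains exactly one Hall `σ i`-subgroup of `G`. -/
def CompleteHallSigmaSet {ι : Type*} (σ : ι → Set ℕ) (G : Type*) [Group G]
    (ℋ : Set (Subgroup G)) : Prop :=
  (∀ H ∈ ℋ, H ≠ ⊥ → ∃ i, IsHallSigmaSubgroup σ i H) ∧
  ∀ i, (∃ p : ℕ, p.Prime ∧ p ∈ σ i ∧ p ∣ Nat.card G) →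
    ∃! H : Subgroup G, H ∈ ℋ ∧ IsHallSigmaSubgroup σ i H

/-- A subgroup `A` is `σ`-permutable in `G` if `G` has a complete Hall `σ`-set `ℋ`
with `A Hˣ = Hˣ A` for all `H ∈ ℋ` and all `x ∈ G`. -/
def SigmaPermutable {ι : Type*} (σ : ι → Set ℕ) {G : Type*} [Group G]
    (A : Subgroup G) : Prop :=
  ∃ ℋ : Set (Subgroup G), CompleteHallSigmaSet σ G ℋ ∧
    ∀ H ∈ ℋ, ∀ x : G,
      (A : Set G) * (H.map (MulAut.conj x).toMonoidHom : Set G) =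
        (H.map (MulAut.conj x).toMonoidHom : Set G) * (A : Set G)

/-- `G` is a `PσT`-group: `σ`-permutability is transitive, i.e. if `H` is
`σ`-permutable in `G` and `K` is `σ`-permutable in `H`, then `K` is
`σ`-permutable in `G`. -/
def IsPSigmaT {ι : Type*} (σ : ι → Set ℕ) (G : Type*) [Group G] : Prop :=
  ∀ H : Subgroup G, SigmaPermutable σ H →
    ∀ K : Subgroup ↥H, SigmaPermutable σ K →
      SigmaPermutable σ (K.map H.subtype)

open scoped Pointwise

/-- All prime divisors of `n` lie in `S`. -/
def PrimesIn (S : Set ℕ) (n : ℕ) : Prop := ∀ p : ℕ, p.Prime → p ∣ n → p ∈ S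

/-- `x` has order a power of `p`. -/
def PEl {G : Type*} [Group G] (p : ℕ) (x : G) : Prop := ∃ k : ℕ, x ^ p ^ k = 1

theorem PrimesIn.of_dvd {S : Set ℕ} {m n : ℕ} (h : PrimesIn S n) (hd : m ∣ n) : PrimesIn S m :=
  fun p hp hm => h p hp (hm.trans hd)

theorem PrimesIn.mul {S : Set ℕ} {m n : ℕ} (h : PrimesIn S n) (h' : PrimesIn S m) :
    PrimesIn S (n * m) := fun p hp hm =>
  (hp.dvd_mul.1 hm).elim (h p hp) (h' p hp)

theorem primesIn_one (S : Set ℕ) : PrimesIn S 1 := fun p hp h =>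
  absurd (Nat.dvd_one.1 h) hp.ne_one

theorem primesIn_pow {S : Set ℕ} {p k : ℕ} (hp : p.Prime) (h : p ∈ S) : PrimesIn S (p ^ k) := by
  intro q hq hd
  rw [(Nat.prime_dvd_prime_iff_eq hq hp).1 (hq.dvd_of_dvd_pow hd)]; exact h

theorem eq_one_of_primesIn {S S' : Set ℕ} {n : ℕ} (h : PrimesIn S n) (h' : PrimesIn S' n)
    (hd : ∀ p : ℕ, p.Prime → p ∈ S → p ∈ S' → False) : n = 1 := by
  by_contra hn
  obtain ⟨p, hp, hpn⟩ := Nat.exists_prime_and_dvd hn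
  exact hd p hp (h p hp hpn) (h' p hp hpn)

theorem coprime_of_primesIn {S S' : Set ℕ} {n m : ℕ} (h : PrimesIn S n) (h' : PrimesIn S' m)
    (hd : ∀ p : ℕ, p.Prime → p ∈ S → p ∈ S' → False) : Nat.Coprime n m :=
  Nat.coprime_of_dvd fun p hp hn hm => hd p hp (h p hp hn) (h' p hp hm)

section basic
variable {G : Type*} [Group G]

theorem PEl.map {H : Type*} [Group H] (f : G →* H) {p : ℕ} {x : G} (h : PEl p x) :
    PEl p (f x) := by
  obtain ⟨k, hk⟩ := h
  exact ⟨k, by rw [← map_pow, hk, map_one]⟩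

theorem PEl.conj {p : ℕ} {x : G} (h : PEl p x) (g : G) : PEl p (g * x * g⁻¹) :=
  h.map (MulAut.conj g).toMonoidHom

theorem PEl.inv {p : ℕ} {x : G} (h : PEl p x) : PEl p x⁻¹ := by
  obtain ⟨k, hk⟩ := h
  exact ⟨k, by rw [inv_pow, hk, inv_one]⟩

theorem PEl.zpow {p : ℕ} {x : G} (h : PEl p x) (n : ℤ) : PEl p (x ^ n) := by
  obtain ⟨k, hk⟩ := h
  exact ⟨k, by rw [← zpow_natCast, ← zpow_mul, mul_comm, zpow_mul, zpow_natCast, hk, one_zpow]⟩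

theorem PEl.mul_of_comm {p : ℕ} {x y : G} (h : PEl p x) (h' : PEl p y) (hc : Commute x y) :
    PEl p (x * y) := by
  obtain ⟨k, hk⟩ := h
  obtain ⟨l, hl⟩ := h'
  refine ⟨k + l, ?_⟩
  rw [hc.mul_pow, pow_add, pow_mul, hk, one_pow, mul_comm, pow_mul, hl, one_pow, one_mul]

theorem PEl.coe {H : Subgroup G} {p : ℕ} {x : H} (h : PEl p x) : PEl p (x : G) :=
  h.map H.subtype

theorem PEl.mk {H : Subgroup G} {p : ℕ} {x : G} (h : PEl p x) (hx : x ∈ H) :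
    PEl p (⟨x, hx⟩ : H) := by
  obtain ⟨k, hk⟩ := h
  exact ⟨k, Subtype.ext hk⟩

theorem PEl.orderOf_dvd {p : ℕ} {x : G} (h : PEl p x) : ∃ k, orderOf x ∣ p ^ k := by
  obtain ⟨k, hk⟩ := h
  exact ⟨k, orderOf_dvd_of_pow_eq_one hk⟩

theorem PEl.eq_one_of_ne {p q : ℕ} (hp : p.Prime) (hq : q.Prime) (hpq : p ≠ q) {x : G}
    (h : PEl p x) (h' : PEl q x) : x = 1 := by
  obtain ⟨k, hk⟩ := h.orderOf_dvd
  obtain ⟨l, hl⟩ := h'.orderOf_dvd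
  have : Nat.Coprime (p ^ k) (q ^ l) :=
    Nat.Coprime.pow _ _ ((Nat.coprime_primes hp hq).2 hpq)
  exact orderOf_eq_one_iff.1 (Nat.eq_one_of_dvd_coprimes this hk hl)

theorem PEl.dvd_card {p : ℕ} (hp : p.Prime) {x : G} (h : PEl p x) (hx : x ≠ 1)
    {H : Subgroup G} (hH : x ∈ H) : p ∣ Nat.card H := by
  obtain ⟨k, hk⟩ := h.orderOf_dvd
  obtain ⟨j, -, hj⟩ := (Nat.dvd_prime_pow hp).1 hk
  have h1 : orderOf x ∣ Nat.card H := H.orderOf_dvd_natCard hH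
  rw [hj] at h1
  refine dvd_trans (dvd_pow_self p ?_) h1
  rintro rfl
  rw [pow_zero, orderOf_eq_one_iff] at hj
  exact hx hj

theorem PEl.zpowers_isPGroup {p : ℕ} {x : G} (h : PEl p x) : IsPGroup p (Subgroup.zpowers x) := by
  rintro ⟨y, hy⟩
  obtain ⟨n, rfl⟩ := Subgroup.mem_zpowers_iff.1 hy
  obtain ⟨k, hk⟩ := h.zpow n
  exact ⟨k, Subtype.ext hk⟩

theorem isPGroup_pel {p : ℕ} {H : Subgroup G} (h : IsPGroup p H) {x : G} (hx : x ∈ H) :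
    PEl p x := by
  obtain ⟨k, hk⟩ := h ⟨x, hx⟩
  exact ⟨k, by simpa using congrArg Subtype.val hk⟩

theorem isPGroup_of_pel {p : ℕ} {H : Subgroup G} (h : ∀ x ∈ H, PEl p x) : IsPGroup p H := by
  rintro ⟨x, hx⟩
  obtain ⟨k, hk⟩ := h x hx
  exact ⟨k, Subtype.ext hk⟩

theorem isPGroup_primesIn [Finite G] {p : ℕ} (hp : p.Prime) {H : Subgroup G} (h : IsPGroup p H)
    {S : Set ℕ} (hS : p ∈ S) : PrimesIn S (Nat.card H) := by
  haveI := Fact.mk hp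
  obtain ⟨n, hn⟩ := IsPGroup.iff_card.1 h
  rw [hn]; exact primesIn_pow hp hS

/-- A subgroup containing all elements of prime power order of `K` contains `K`. -/
theorem le_of_pel [Finite G] {K S : Subgroup G}
    (h : ∀ p : ℕ, p.Prime → ∀ x ∈ K, PEl p x → x ∈ S) : K ≤ S := by
  by_contra hn
  rw [← Subgroup.relIndex_eq_one] at hn
  obtain ⟨p, hp, hpn⟩ := Nat.exists_prime_and_dvd hn
  haveI := Fact.mk hp
  obtain ⟨P⟩ : Nonempty (Sylow p K) := inferInstance
  refine P.not_dvd_index (hpn.trans ?_)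
  apply Subgroup.index_dvd_of_le
  intro x hx
  exact h p hp x x.2 (isPGroup_pel P.isPGroup' hx).coe

/-- If `U` and `V` permute then `|U : U ∩ V|` divides `|H : V|`. -/
theorem relIndex_dvd_of_perm {U V H : Subgroup G} (hU : U ≤ H) (hV : V ≤ H)
    (hp : ∀ u ∈ U, ∀ v ∈ V, ∃ u' ∈ U, ∃ v' ∈ V, v * u = u' * v') :
    V.relIndex U ∣ V.relIndex H := by
  let S : Subgroup G :=
    { carrier := {g | ∃ u ∈ U, ∃ v ∈ V, g = u * v}
      one_mem' := ⟨1, U.one_mem, 1, V.one_mem, by simp⟩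
      mul_mem' := by
        rintro a b ⟨u, hu, v, hv, rfl⟩ ⟨u1, hu1, v1, hv1, rfl⟩
        obtain ⟨u2, hu2, v2, hv2, e⟩ := hp u1 hu1 v hv
        refine ⟨u * u2, U.mul_mem hu hu2, v2 * v1, V.mul_mem hv2 hv1, ?_⟩
        calc u * v * (u1 * v1) = u * (v * u1) * v1 := by group
          _ = _ := by rw [e]; group
      inv_mem' := by
        rintro a ⟨u, hu, v, hv, rfl⟩
        obtain ⟨u2, hu2, v2, hv2, e⟩ := hp u⁻¹ (U.inv_mem hu) v⁻¹ (V.inv_mem hv)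
        exact ⟨u2, hu2, v2, hv2, by rw [← e]; group⟩ }
  have hUS : U ≤ S := fun u hu => ⟨u, hu, 1, V.one_mem, by simp⟩
  have hVS : V ≤ S := fun u hu => ⟨1, U.one_mem, u, hu, by simp⟩
  have hSH : S ≤ H := by
    rintro g ⟨u, hu, v, hv, rfl⟩
    exact H.mul_mem (hU hu) (hV hv)
  have key : V.relIndex U = V.relIndex S := by
    unfold Subgroup.relIndex Subgroup.index
    refine Nat.card_congr (Equiv.ofBijective
      (Subgroup.quotientSubgroupOfEmbeddingOfLE V hUS) ⟨Function.Embedding.injective _, ?_⟩)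
    intro q
    induction q using QuotientGroup.induction_on with
    | H z =>
      obtain ⟨z, u, hu, v, hv, rfl⟩ := z
      refine ⟨QuotientGroup.mk ⟨u, hu⟩, ?_⟩
      rw [Subgroup.quotientSubgroupOfEmbeddingOfLE_apply_mk, QuotientGroup.eq]
      rw [Subgroup.mem_subgroupOf]
      simpa using hv
  rw [key, ← Subgroup.relIndex_mul_relIndex V S H hVS hSH]
  exact dvd_mul_right _ _

theorem relIndex_dvd_of_normalizes {U V H : Subgroup G} (hU : U ≤ H) (hV : V ≤ H)
    (hp : ∀ u ∈ U, ∀ v ∈ V, v * u * v⁻¹ ∈ U) :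
    V.relIndex U ∣ V.relIndex H := by
  refine relIndex_dvd_of_perm hU hV fun u hu v hv => ⟨_, hp u hu v hv, v, hv, by group⟩

theorem relIndex_dvd_of_normal {U V H : Subgroup G} (hU : U ≤ H) (hV : V.Normal) :
    V.relIndex U ∣ V.relIndex H := by
  have h1 : (V ⊓ H).relIndex U ∣ (V ⊓ H).relIndex H := by
    refine relIndex_dvd_of_perm hU inf_le_right fun u hu v hv => ⟨u, hu, u⁻¹ * v * u, ⟨?_, ?_⟩, ?_⟩
    · simpa using hV.conj_mem v hv.1 u⁻¹
    · exact H.mul_mem (H.mul_mem (H.inv_mem (hU hu)) hv.2) (hU hu)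
    · group
  rw [Subgroup.inf_relIndex_right] at h1
  refine dvd_trans ?_ h1
  exact Subgroup.relIndex_dvd_of_le_left U inf_le_left

/-- Existence of a maximal subgroup of `Q` containing a proper subgroup `Q0`. -/
theorem exists_maximal_between [Finite G] {Q0 Q : Subgroup G} (h : Q0 < Q) :
    ∃ V, Q0 ≤ V ∧ V < Q ∧ ∀ W, V < W → W ≤ Q → W = Q := by
  obtain ⟨V, hV⟩ := (Set.toFinite {V : Subgroup G | Q0 ≤ V ∧ V < Q}).exists_maximal ⟨Q0, le_rfl, h⟩
  refine ⟨V, hV.1.1, hV.1.2, fun W hW hWQ => ?_⟩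
  by_contra hne
  exact absurd (hV.2 ⟨hV.1.1.trans hW.le, lt_of_le_of_ne hWQ hne⟩ hW.le) (not_le_of_gt hW)

/-- Central Hall subgroups: the set of elements `g` with `g ^ |G : Z| = 1` is a subgroup
complementing `Z`. -/
theorem central_hall [Finite G] (Z : Subgroup G) (hZ : ∀ z ∈ Z, ∀ g : G, z * g = g * z)
    (hc : Nat.Coprime (Nat.card Z) Z.index) :
    ∃ B : Subgroup G, (∀ g, g ∈ B ↔ g ^ Z.index = 1) ∧ Nat.card B = Z.index := by
  have key : ∀ g : G, ∀ (k : ℕ) (g₀ : G), g₀⁻¹ * g ^ k * g₀ ∈ Z → g₀⁻¹ * g ^ k * g₀ = g ^ k := by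
    intro g k g₀ h
    have := hZ _ h g₀⁻¹
    have h2 : g₀⁻¹ * (g₀⁻¹ * g ^ k * g₀) * g₀ = g₀⁻¹ * g ^ k * g₀ := by
      rw [← this]; group
    have h3 : g₀⁻¹ * g ^ k * g₀ = g ^ k := by
      have h4 := congrArg (fun t => g₀ * t * g₀⁻¹) h2
      simpa [mul_assoc] using h4
    exact h3
  letI : CommGroup Z := { (inferInstance : Group Z) with
    mul_comm := fun a b => Subtype.ext (hZ a a.2 b) }
  let ψ : G →* Z := MonoidHom.transfer (MonoidHom.id Z)
  have hψ : ∀ g, ((ψ g : Z) : G) = g ^ Z.index := by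
    intro g
    have := MonoidHom.transfer_eq_pow (MonoidHom.id Z) g (key g)
    have h2 := congrArg Subtype.val this
    simpa using h2
  have hB : ∀ g, g ∈ ψ.ker ↔ g ^ Z.index = 1 := by
    intro g
    rw [MonoidHom.mem_ker, ← hψ g]
    exact Subtype.ext_iff
  refine ⟨ψ.ker, hB, ?_⟩
  have hsurj : Function.Surjective ψ := by
    have hinj : Function.Injective (ψ.comp Z.subtype) := by
      rw [injective_iff_map_eq_one]
      intro z hz
      have h1 : (z : G) ^ Z.index = 1 := by rw [← hψ]; exact congrArg Subtype.val hz
      have h2 : orderOf (z : G) ∣ Z.index := orderOf_dvd_of_pow_eq_one h1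
      have h3 : orderOf (z : G) ∣ Nat.card Z := Z.orderOf_dvd_natCard z.2
      have := Nat.eq_one_of_dvd_coprimes hc h3 h2
      exact Subtype.ext (orderOf_eq_one_iff.1 this)
    have hs := Finite.surjective_of_injective hinj
    intro z
    obtain ⟨w, hw⟩ := hs z
    exact ⟨w, hw⟩
  have h1 : ψ.ker.index = Nat.card Z := by
    rw [Subgroup.index_ker, MonoidHom.range_eq_top.2 hsurj, Subgroup.card_top]
  have h2 := ψ.ker.card_mul_index
  rw [h1, ← Z.card_mul_index, mul_comm] at h2
  exact Nat.eq_of_mul_eq_mul_left Nat.card_pos h2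

end basic

open scoped Pointwise

section power
variable {G : Type*} [Group G]

theorem zpow_gen {r : ℕ} (hr : r.Prime) {c : G} (hc : PEl r c) {n : ℤ} (hn : ¬ (r : ℤ) ∣ n) :
    ∃ l : ℤ, c = (c ^ n) ^ l := by
  obtain ⟨k, hk⟩ := hc
  have h1 : IsCoprime n ((r : ℤ) ^ k) := by
    refine IsCoprime.pow_right ?_
    exact ((Nat.prime_iff_prime_int.1 hr).coprime_iff_not_dvd.2 hn).symm
  obtain ⟨a, b, hab⟩ := h1
  refine ⟨a, ?_⟩
  have h2 : c ^ ((r : ℤ) ^ k) = 1 := by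
    rw [← hk, ← zpow_natCast]; push_cast; rfl
  calc c = c ^ (a * n + b * (r : ℤ) ^ k) := by rw [hab, zpow_one]
    _ = (c ^ n) ^ a * (c ^ ((r : ℤ) ^ k)) ^ b := by
      rw [zpow_add, mul_comm a, mul_comm b, zpow_mul, zpow_mul]
    _ = _ := by rw [h2, one_zpow, mul_one]

theorem eq_one_of_zpow {r : ℕ} (hr : r.Prime) {c : G} (hc : PEl r c) {n : ℤ}
    (hn : ¬ (r : ℤ) ∣ n) (h : c ^ n = 1) : c = 1 := by
  obtain ⟨l, hl⟩ := zpow_gen hr hc hn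
  rw [hl, h, one_zpow]

theorem int_lift {r : ℕ} (hr : r.Prime) {Q e : ℕ} (hQ : ¬ r ∣ Q) {a b : ℤ}
    (hab : (r : ℤ) ∣ a - b) (ha : ¬ (r : ℤ) ∣ a) (h : (r : ℤ) ^ e ∣ a ^ Q - b ^ Q) :
    (r : ℤ) ^ e ∣ a - b := by
  have := emultiplicity_pow_sub_pow_of_prime (Nat.prime_iff_prime_int.1 hr) hab ha
    (n := Q) (by exact_mod_cast hQ)
  rw [pow_dvd_iff_le_emultiplicity] at h ⊢
  rwa [this] at h

theorem conj_iter {x h : G} {m : ℤ} (hm : x * h * x⁻¹ = h ^ m) (j : ℕ) :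
    x ^ j * h * (x ^ j)⁻¹ = h ^ (m ^ j) := by
  induction j with
  | zero => simp
  | succ j ih =>
    have : x ^ (j + 1) * h * (x ^ (j + 1))⁻¹ = x * (x ^ j * h * (x ^ j)⁻¹) * x⁻¹ := by
      rw [pow_succ']; group
    rw [this, ih, ← conj_zpow, hm, ← zpow_mul, pow_succ']

theorem order_dvd_of_conj {x h : G} {m : ℤ} (hm : x * h * x⁻¹ = h ^ m) {Q : ℕ} (hx : x ^ Q = 1) :
    (orderOf h : ℤ) ∣ m ^ Q - 1 := by
  have h1 := conj_iter hm Q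
  rw [hx] at h1
  rw [orderOf_dvd_iff_zpow_eq_one, zpow_sub, ← h1]
  simp

theorem order_eq {r : ℕ} (hr : r.Prime) {h : G} (hh : PEl r h) : ∃ e, orderOf h = r ^ e := by
  obtain ⟨k, hk⟩ := hh.orderOf_dvd
  obtain ⟨j, -, hj⟩ := (Nat.dvd_prime_pow hr).1 hk
  exact ⟨j, hj⟩

theorem not_dvd_prime_pow {q r : ℕ} (hq : q.Prime) (hr : r.Prime) (hqr : q ≠ r) (k : ℕ) :
    ¬ r ∣ q ^ k := fun h =>
  hqr ((Nat.prime_dvd_prime_iff_eq hr hq).1 (hr.dvd_of_dvd_pow h)).symm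

/-- exponents of a coprime power action on an `r`-element that is not fixed -/
theorem pw1 {q r : ℕ} (hq : q.Prime) (hr : r.Prime) (hqr : q ≠ r) {x h : G} (hx : PEl q x)
    (hh : PEl r h) {m : ℤ} (hm : x * h * x⁻¹ = h ^ m) (hn : x * h ≠ h * x) :
    ¬ (r : ℤ) ∣ m - 1 := by
  intro hd
  apply hn
  obtain ⟨k, hk⟩ := hx
  obtain ⟨e, he⟩ := order_eq hr hh
  have h1 := order_dvd_of_conj hm hk
  rw [he] at h1
  push_cast at h1
  have hm1 : ¬ (r : ℤ) ∣ m := by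
    intro h2
    have h3 : (r : ℤ) ∣ 1 := by simpa using dvd_sub h2 hd
    exact (Nat.prime_iff_prime_int.1 hr).not_unit (isUnit_of_dvd_one h3)
  have h2 := int_lift hr (not_dvd_prime_pow hq hr hqr k) hd hm1 (e := e) (by simpa using h1)
  have h3 : h ^ (m - 1) = 1 := by
    rw [← orderOf_dvd_iff_zpow_eq_one, he]
    push_cast; exact h2
  have h4 : h ^ m = h := by
    rw [zpow_sub, zpow_one, mul_inv_eq_one] at h3
    exact h3
  rw [h4] at hm
  calc x * h = x * h * x⁻¹ * x := by group
    _ = h * x := by rw [hm]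

/-- `x` normalises every subgroup of `L`. -/
def PowAct (x : G) (L : Subgroup G) : Prop := ∀ A ≤ L, ∀ a ∈ A, x * a * x⁻¹ ∈ A

theorem PowAct.exp {x : G} {L : Subgroup G} (h : PowAct x L) {a : G} (ha : a ∈ L) :
    ∃ m : ℤ, x * a * x⁻¹ = a ^ m := by
  obtain ⟨m, hm⟩ := Subgroup.mem_zpowers_iff.1
    (h (Subgroup.zpowers a) (by simpa using ha) a (Subgroup.mem_zpowers a))
  exact ⟨m, hm.symm⟩

theorem ne_of_pel_mem {q r : ℕ} (hr : r.Prime) {L : Subgroup G} (hqL : ¬ q ∣ Nat.card L)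
    {h : G} (hh : PEl r h) (hL : h ∈ L) (h1 : h ≠ 1) : q ≠ r := by
  rintro rfl
  exact hqL (hh.dvd_card hr h1 hL)

theorem conj_stab_zpow {c : G} (Z : Subgroup G) [Finite G] (h : ∀ a ∈ Z, c * a * c⁻¹ ∈ Z) (n : ℤ) :
    ∀ a ∈ Z, c ^ n * a * (c ^ n)⁻¹ ∈ Z := by
  have hc : c ∈ Subgroup.normalizer (Z : Set G) := by
    have h2 : Z.map (MulAut.conj c).toMonoidHom ≤ Z := by
      rintro _ ⟨a, ha, rfl⟩
      exact h a ha
    have h3 : Z.map (MulAut.conj c).toMonoidHom = Z := by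
      apply Subgroup.eq_of_le_of_card_ge h2
      exact (Nat.card_congr (Z.equivMapOfInjective _ (MulAut.conj c).injective).toEquiv).le
    rw [Subgroup.mem_normalizer_iff]
    intro a
    refine ⟨h a, fun ha => ?_⟩
    have ha' : c * a * c⁻¹ ∈ Z := ha
    rw [← h3] at ha'
    obtain ⟨b, hb, e⟩ := ha'
    have : b = a := by
      apply (MulAut.conj c).injective
      exact e
    exact this ▸ hb
  intro a ha
  exact (Subgroup.mem_normalizer_iff.1 (Subgroup.zpow_mem _ hc n) a).1 ha

/-- Under a coprime power action, moved `r`-elements are central. -/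
theorem pw_central [Finite G] {q r : ℕ} (hq : q.Prime) (hr : r.Prime) {x : G} (hx : PEl q x)
    {L : Subgroup G} (hqL : ¬ q ∣ Nat.card L) (hxL : PowAct x L) {h : G} (hh : PEl r h)
    (hL : h ∈ L) (hn : x * h ≠ h * x) : ∀ g ∈ L, h * g = g * h := by
  have hqr : q ≠ r := ne_of_pel_mem hr hqL hh hL (by rintro rfl; simp at hn)
  obtain ⟨m, hm⟩ := hxL.exp hL
  have hm1 := pw1 hq hr hqr hx hh hm hn
  obtain ⟨l, hl⟩ := zpow_gen hr hh hm1
  intro g hg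
  -- `x⁻¹` also acts
  have hxi : ∀ A ≤ L, ∀ a ∈ A, x⁻¹ * a * x ∈ A := by
    intro A hA a ha
    have := conj_stab_zpow A (hxL A hA) (-1) a ha
    simpa using this
  -- step 1: `h ^ (m - 1)` normalises `⟨g⟩`
  have s1 : ∀ a ∈ Subgroup.zpowers g, h ^ (m - 1) * a * (h ^ (m - 1))⁻¹ ∈ Subgroup.zpowers g := by
    intro a ha
    have hgL : Subgroup.zpowers g ≤ L := by simpa using hg
    have h1 := hxi _ hgL a ha
    let C : Subgroup G := (Subgroup.zpowers g).map (MulAut.conj h).toMonoidHom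
    have hCL : C ≤ L := by
      rintro _ ⟨b, hb, rfl⟩
      exact L.mul_mem (L.mul_mem hL (hgL hb)) (L.inv_mem hL)
    have h2 : h * (x⁻¹ * a * x) * h⁻¹ ∈ C := ⟨_, h1, rfl⟩
    have h3 := hxL C hCL _ h2
    have h4 : x * (h * (x⁻¹ * a * x) * h⁻¹) * x⁻¹ = h ^ m * a * (h ^ m)⁻¹ := by
      rw [← hm]; group
    rw [h4] at h3
    obtain ⟨b, hb, e⟩ := h3
    have e' : h * b * h⁻¹ = h ^ m * a * (h ^ m)⁻¹ := e
    have h5 : h ^ (m - 1) * a * (h ^ (m - 1))⁻¹ = b := by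
      have : h ^ (m - 1) = h⁻¹ * h ^ m := by rw [zpow_sub_one, ← zpow_neg_one, ← zpow_add, ← zpow_add, add_comm]
      rw [this]
      calc h⁻¹ * h ^ m * a * (h⁻¹ * h ^ m)⁻¹ = h⁻¹ * (h ^ m * a * (h ^ m)⁻¹) * h := by group
        _ = b := by rw [← e']; group
    rw [h5]; exact hb
  have s2 : h * g * h⁻¹ ∈ Subgroup.zpowers g := by
    have := conj_stab_zpow _ s1 l g (Subgroup.mem_zpowers g)
    rwa [← hl] at this
  obtain ⟨a, ha⟩ := Subgroup.mem_zpowers_iff.1 s2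
  obtain ⟨b, hb⟩ := Subgroup.mem_zpowers_iff.1
    (hxi (Subgroup.zpowers g) (by simpa using hg) g (Subgroup.mem_zpowers g))
  have s3 : h ^ m * g * (h ^ m)⁻¹ = h * g * h⁻¹ := by
    rw [← hm]
    calc x * h * x⁻¹ * g * (x * h * x⁻¹)⁻¹ = x * (h * (x⁻¹ * g * x) * h⁻¹) * x⁻¹ := by group
      _ = x * (h * g * h⁻¹) ^ b * x⁻¹ := by rw [← hb, conj_zpow]
      _ = x * (g ^ b) ^ a * x⁻¹ := by rw [← ha, ← zpow_mul, ← zpow_mul, mul_comm]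
      _ = (x * (x⁻¹ * g * x) * x⁻¹) ^ a := by rw [hb, conj_zpow]
      _ = g ^ a := by group
      _ = _ := ha
  have s4 : Commute (h ^ (m - 1)) g := by
    have e1 : h ^ m = h * h ^ (m - 1) := by
      rw [← zpow_one_add]; congr 1; ring
    rw [e1] at s3
    have : h ^ (m - 1) * g * (h ^ (m - 1))⁻¹ = g := by
      have h2 := congrArg (fun t => h⁻¹ * t * h) s3
      simp only [mul_inv_rev] at h2
      calc h ^ (m - 1) * g * (h ^ (m - 1))⁻¹
          = h⁻¹ * (h * h ^ (m - 1) * g * ((h ^ (m - 1))⁻¹ * h⁻¹)) * h := by group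
        _ = h⁻¹ * (h * g * h⁻¹) * h := h2
        _ = g := by group
    exact mul_inv_eq_iff_eq_mul.1 this
  have s5 := s4.zpow_left l
  rw [← hl] at s5
  exact s5

/-- Dichotomy: if some `r`-element of `L` is moved, no nontrivial `r`-element is fixed. -/
theorem pw_fpf [Finite G] {q r : ℕ} (hq : q.Prime) (hr : r.Prime) {x : G} (hx : PEl q x)
    {L : Subgroup G} (hqL : ¬ q ∣ Nat.card L) (hxL : PowAct x L) {h : G} (hh : PEl r h)
    (hL : h ∈ L) (hn : x * h ≠ h * x) {c : G} (hc : PEl r c) (hcL : c ∈ L)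
    (hcx : x * c = c * x) : c = 1 := by
  have hqr : q ≠ r := ne_of_pel_mem hr hqL hh hL (by rintro rfl; simp at hn)
  have hcent := pw_central hq hr hx hqL hxL hh hL hn c hcL
  have hcomm : Commute h c := hcent
  obtain ⟨m, hm⟩ := hxL.exp hL
  have hm1 := pw1 hq hr hqr hx hh hm hn
  obtain ⟨l, hl⟩ := hxL.exp (L.mul_mem hL hcL)
  have hn2 : x * (h * c) ≠ (h * c) * x := by
    intro e
    apply hn
    have : x * h * c = h * x * c := by rw [mul_assoc, e, mul_assoc, mul_assoc, hcx]
    exact mul_right_cancel this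
  have hl1 := pw1 hq hr hqr hx (hh.mul_of_comm hc hcomm) hl hn2
  have hxc : x * c * x⁻¹ = c := by rw [hcx]; group
  have e1 : h ^ m * c = h ^ l * c ^ l := by
    rw [← hcomm.mul_zpow, ← hl, ← hm]
    calc x * h * x⁻¹ * c = x * h * x⁻¹ * (x * c * x⁻¹) := by rw [hxc]
      _ = _ := by group
  have e2 : c ^ (l - 1) = h ^ (m - l) := by
    rw [zpow_sub_one]
    have hcl : Commute (h ^ l) (c ^ l) := (hcomm.zpow_left l).zpow_right l
    have : c ^ l = (h ^ l)⁻¹ * (h ^ m * c) := by rw [e1]; group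
    rw [this, ← mul_assoc, ← zpow_neg, ← zpow_add, mul_assoc, mul_inv_cancel, mul_one]
    congr 1; ring
  obtain ⟨j, hj⟩ := zpow_gen hr hc hl1
  rw [e2, ← zpow_mul] at hj
  set i := (m - l) * j
  have e3 : c ^ m = c := by
    calc c ^ m = (h ^ m) ^ i := by rw [hj, ← zpow_mul, ← zpow_mul, mul_comm]
      _ = x * c * x⁻¹ := by rw [← hm, conj_zpow, ← hj]
      _ = c := hxc
  apply eq_one_of_zpow hr hc hm1
  rw [zpow_sub_one, e3, mul_inv_cancel]

/-- exponents agree modulo `r` -/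
theorem pw_exp_mod {r : ℕ} (hr : r.Prime) {x : G} {L : Subgroup G} (hxL : PowAct x L)
    (hab : ∀ a ∈ L, ∀ b ∈ L, a * b = b * a) {a b : G} (ha : a ∈ L) (hb : b ∈ L)
    (hao : orderOf a = r) (hbo : orderOf b = r) {n n' : ℤ}
    (hn : x * a * x⁻¹ = a ^ n) (hn' : x * b * x⁻¹ = b ^ n') : (r : ℤ) ∣ n - n' := by
  by_cases hba : b ∈ Subgroup.zpowers a
  · obtain ⟨j, rfl⟩ := Subgroup.mem_zpowers_iff.1 hba
    rw [← hbo, orderOf_dvd_iff_zpow_eq_one, zpow_sub, ← hn', ← conj_zpow, hn]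
    rw [← zpow_mul, ← zpow_mul, mul_comm, mul_inv_cancel]
  · have hcomm : Commute a b := hab a ha b hb
    obtain ⟨l, hl⟩ := hxL.exp (L.mul_mem ha hb)
    have e1 : a ^ n * b ^ n' = a ^ l * b ^ l := by
      rw [← hcomm.mul_zpow, ← hl, ← hn, ← hn']; group
    have e2 : b ^ (n' - l) = a ^ (l - n) := by
      have h1 : b ^ n' = (a ^ n)⁻¹ * (a ^ l * b ^ l) := by rw [← e1]; group
      rw [zpow_sub, h1, ← mul_assoc, ← zpow_neg, ← zpow_add, mul_assoc, mul_inv_cancel, mul_one]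
      congr 1; ring
    have hbp : PEl r b := ⟨1, by rw [pow_one, ← hbo, pow_orderOf_eq_one]⟩
    have d1 : (r : ℤ) ∣ n' - l := by
      by_contra hd
      obtain ⟨i, hi⟩ := zpow_gen hr hbp hd
      apply hba
      rw [hi, e2, ← zpow_mul]
      exact Subgroup.zpow_mem _ (Subgroup.mem_zpowers a) _
    have d2 : (r : ℤ) ∣ l - n := by
      rw [← hao, orderOf_dvd_iff_zpow_eq_one, ← e2, ← orderOf_dvd_iff_zpow_eq_one, hbo]
      exact d1
    have := dvd_add d1 d2
    rw [← dvd_neg]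
    convert this using 1; ring

/-- Coprime power actions on normal abelian `r`-groups commute with all automorphisms. -/
theorem pw_univ {q r : ℕ} (hq : q.Prime) (hr : r.Prime) (hqr : q ≠ r) {x : G} (hx : PEl q x)
    {L : Subgroup G} (hN : L.Normal) (hxL : PowAct x L)
    (hab : ∀ a ∈ L, ∀ b ∈ L, a * b = b * a) {a : G} (ha : a ∈ L) (har : PEl r a) (y : G) :
    x * (y * a * y⁻¹) * x⁻¹ = y * (x * a * x⁻¹) * y⁻¹ := by
  by_cases ha1 : a = 1
  · subst ha1; simp
  obtain ⟨k, hk⟩ := hx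
  obtain ⟨e, he⟩ := order_eq hr har
  have hb : y * a * y⁻¹ ∈ L := hN.conj_mem a ha y
  obtain ⟨n, hn⟩ := hxL.exp ha
  obtain ⟨n', hn'⟩ := hxL.exp hb
  have hbo : orderOf (y * a * y⁻¹) = r ^ e := by
    rw [← he]; exact orderOf_injective (MulAut.conj y).toMonoidHom (MulAut.conj y).injective a
  have he0 : e ≠ 0 := by
    rintro rfl
    rw [pow_zero, orderOf_eq_one_iff] at he
    exact ha1 he
  obtain ⟨f, rfl⟩ := Nat.exists_eq_succ_of_ne_zero he0
  have ho : ∀ c : G, orderOf c = r ^ (f + 1) → orderOf (c ^ r ^ f) = r := by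
    intro c hc
    rw [orderOf_pow_of_dvd (pow_ne_zero _ hr.ne_zero) (by rw [hc]; exact pow_dvd_pow _ (by omega)), hc,
      pow_succ, Nat.mul_div_cancel_left _ (pow_pos hr.pos _)]
  have hcp : ∀ (c : G) (t : ℤ), x * c * x⁻¹ = c ^ t →
      x * (c ^ r ^ f) * x⁻¹ = (c ^ r ^ f) ^ t := by
    intro c t h
    rw [← conj_pow, h, ← zpow_natCast, ← zpow_natCast, ← zpow_mul, ← zpow_mul, mul_comm]
  have hmod : (r : ℤ) ∣ n' - n := pw_exp_mod hr hxL hab (L.pow_mem hb _) (L.pow_mem ha _)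
    (ho _ hbo) (ho _ he) (hcp _ _ hn') (hcp _ _ hn)
  have h1 := order_dvd_of_conj hn hk
  have h2 := order_dvd_of_conj hn' hk
  rw [he] at h1
  rw [hbo] at h2
  push_cast at h1 h2
  have hnd : ¬ (r : ℤ) ∣ n' := by
    intro h3
    have h4 : (r : ℤ) ∣ n' ^ q ^ k := dvd_pow h3 (pow_ne_zero _ hq.ne_zero)
    have h5 : (r : ℤ) ∣ n' ^ q ^ k - 1 := (dvd_pow_self _ (Nat.succ_ne_zero f)).trans h2
    have h6 : (r : ℤ) ∣ 1 := by simpa using dvd_sub h4 h5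
    exact (Nat.prime_iff_prime_int.1 hr).not_unit (isUnit_of_dvd_one h6)
  have h3 := int_lift hr (not_dvd_prime_pow hq hr hqr k) hmod hnd (e := f + 1)
    (by have := dvd_sub h2 h1; simpa using this)
  have h4 : (y * a * y⁻¹) ^ (n' - n) = 1 := by
    rw [← orderOf_dvd_iff_zpow_eq_one, hbo]; push_cast; exact h3
  rw [zpow_sub, mul_inv_eq_one] at h4
  rw [hn', h4, hn, conj_zpow]

end power

open scoped Pointwise

theorem sp_eq {ι : Type*} {σ : ι → Set ℕ} (hσ : SigmaPartition σ) {i j : ι} {p : ℕ}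
    (hi : p ∈ σ i) (hj : p ∈ σ j) : i = j := by
  by_contra hne
  exact Set.disjoint_left.1 (hσ.2.1 hne) hi hj

theorem sp_ex {ι : Type*} {σ : ι → Set ℕ} (hσ : SigmaPartition σ) {p : ℕ} (hp : p.Prime) :
    ∃ i, p ∈ σ i := by
  have : p ∈ ⋃ i, σ i := by rw [hσ.2.2]; exact hp
  simpa using this

theorem sp_disj {ι : Type*} {σ : ι → Set ℕ} (hσ : SigmaPartition σ) {i j : ι} (hij : i ≠ j) :
    ∀ p : ℕ, p.Prime → p ∈ σ i → p ∈ σ j → False := fun _ _ h h' => hij (sp_eq hσ h h')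

/-- working version of `σ`-solubility -/
def SS {ι : Type*} (σ : ι → Set ℕ) (G : Type*) [Group G] : Prop :=
  ∀ M : Subgroup G, M.Normal → M ≠ ⊤ →
    ∃ N : Subgroup G, N.Normal ∧ M < N ∧ ∃ i, PrimesIn (σ i) (M.relIndex N)

/-- the power-automorphism condition -/
def StarC {ι : Type*} (σ : ι → Set ℕ) (G : Type*) [Group G] : Prop :=
  ∀ (i : ι) (M N : Subgroup G), M.Normal → N.Normal → M ≤ N → PrimesIn (σ i) (M.relIndex N) →
    ∀ A : Subgroup G, M ≤ A → A ≤ N → ∀ q : ℕ, q.Prime → q ∉ σ i → ∀ x : G, PEl q x →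
      ∀ a ∈ A, x * a * x⁻¹ ∈ A

section ssbasic
variable {ι : Type*} {σ : ι → Set ℕ} {G : Type*} [Group G]

theorem SigmaSoluble.ss (h : SigmaSoluble σ G) : SS σ G := by
  obtain ⟨n, c, h0, hl, hm, hn, hp⟩ := h
  intro M hM hMt
  have hk : ∃ k : Fin n, c k.castSucc ≤ M ∧ ¬ c k.succ ≤ M := by
    by_contra hcon
    push Not at hcon
    have : ∀ k, c k ≤ M := by
      intro k
      induction k using Fin.induction with
      | zero => rw [h0]; exact bot_le
      | succ k ih => exact hcon k ih
    have h2 := this (Fin.last n)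
    rw [hl] at h2
    exact hMt (top_le_iff.1 h2)
  obtain ⟨k, hk1, hk2⟩ := hk
  haveI := hn k.succ
  refine ⟨M ⊔ c k.succ, inferInstance, ?_, ?_⟩
  · exact lt_of_le_of_ne le_sup_left fun h => hk2 (by rw [h]; exact le_sup_right)
  · obtain ⟨i, hi⟩ := hp k
    refine ⟨i, PrimesIn.of_dvd (n := (c k.castSucc).relIndex (c k.succ)) hi ?_⟩
    rw [Subgroup.relIndex_sup_left]
    exact Subgroup.relIndex_dvd_of_le_left _ hk1

theorem SS.sigmaSoluble [Finite G] (h : SS σ G) : SigmaSoluble σ G := by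
  let S : Set (Subgroup G) := {M | ∃ (n : ℕ) (c : Fin (n + 1) → Subgroup G),
    c 0 = ⊥ ∧ c (Fin.last n) = M ∧ Monotone c ∧ (∀ k, (c k).Normal) ∧
    ∀ k : Fin n, ∃ i, ∀ p : ℕ, p.Prime →
      p ∣ ((c k.castSucc).subgroupOf (c k.succ)).index → p ∈ σ i}
  have hS : S.Nonempty := by
    refine ⟨⊥, 0, fun _ => ⊥, rfl, rfl, fun _ _ _ => le_rfl, fun _ => inferInstance, fun k => k.elim0⟩
  obtain ⟨M, hM⟩ := (Set.toFinite S).exists_maximal hS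
  obtain ⟨n, c, h0, hl, hm, hn, hp⟩ := hM.1
  by_cases hMt : M = ⊤
  · exact ⟨n, c, h0, hl.trans hMt, hm, hn, hp⟩
  exfalso
  obtain ⟨N, hN, hMN, i, hi⟩ := h M (hl ▸ hn _) hMt
  refine hMN.not_ge (hM.2 (y := N) ?_ hMN.le)
  refine ⟨n + 1, Fin.snoc (α := fun _ => Subgroup G) c N, ?_, ?_, ?_, ?_, ?_⟩
  · have : (0 : Fin (n + 1 + 1)) = Fin.castSucc 0 := rfl
    rw [this, Fin.snoc_castSucc, h0]
  · rw [Fin.snoc_last]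
  · rw [Fin.monotone_iff_le_succ]
    intro k
    rw [Fin.snoc_castSucc]
    induction k using Fin.lastCases with
    | last => rw [Fin.succ_last, Fin.snoc_last, hl]; exact hMN.le
    | cast k => rw [Fin.succ_castSucc, Fin.snoc_castSucc]; exact hm (Fin.castSucc_le_succ k)
  · intro k
    induction k using Fin.lastCases with
    | last => rw [Fin.snoc_last]; exact hN
    | cast k => rw [Fin.snoc_castSucc]; exact hn k
  · intro k
    rw [Fin.snoc_castSucc]
    induction k using Fin.lastCases with
    | last => rw [Fin.succ_last, Fin.snoc_last, hl]; exact ⟨i, hi⟩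
    | cast k => rw [Fin.succ_castSucc, Fin.snoc_castSucc]; exact hp k

theorem SigmaSoluble.subgroup (h : SigmaSoluble σ G) (H : Subgroup G) : SigmaSoluble σ H := by
  obtain ⟨n, c, h0, hl, hm, hn, hp⟩ := h
  refine ⟨n, fun k => (c k).subgroupOf H, ?_, ?_, ?_, ?_, ?_⟩
  · simp [h0]
  · simp [hl]
  · intro a b hab
    exact Subgroup.comap_mono (hm hab)
  · intro k
    haveI := hn k
    infer_instance
  · intro k
    obtain ⟨i, hi⟩ := hp k
    refine ⟨i, PrimesIn.of_dvd (n := (c k.castSucc).relIndex (c k.succ)) hi ?_⟩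
    change ((c k.castSucc).subgroupOf H).relIndex ((c k.succ).subgroupOf H) ∣ _
    unfold Subgroup.subgroupOf
    rw [Subgroup.relIndex_comap]
    exact relIndex_dvd_of_normal (Subgroup.map_comap_le _ _) (hn _)

theorem SS.subgroup [Finite G] (h : SS σ G) (H : Subgroup G) : SS σ H :=
  (h.sigmaSoluble.subgroup H).ss

theorem SS.image {H : Type*} [Group H] (h : SS σ G) (f : G →* H) (hf : Function.Surjective f) :
    SS σ H := by
  intro M hM hMt
  obtain ⟨N, hN, hMN, i, hi⟩ := h (M.comap f) inferInstance (by
    intro hc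
    apply hMt
    rw [← Subgroup.map_comap_eq_self_of_surjective hf M, hc]
    exact Subgroup.map_top_of_surjective f hf)
  refine ⟨N.map f, hN.map f hf, ?_, i, ?_⟩
  · refine lt_of_le_of_ne ?_ ?_
    · rw [← Subgroup.map_comap_eq_self_of_surjective hf M]
      exact Subgroup.map_mono hMN.le
    · intro he
      apply hMN.not_ge
      rw [he]
      exact Subgroup.le_comap_map _ _
  · rwa [← Subgroup.relIndex_comap]

theorem pel_lift [Finite G] {H : Type*} [Group H] (f : G →* H) (hf : Function.Surjective f) {q : ℕ}
    (hq : q.Prime) {x : H} (hx : PEl q x) : ∃ y : G, PEl q y ∧ f y = x := by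
  obtain ⟨g, rfl⟩ := hf x
  obtain ⟨k, hk⟩ := hx
  obtain ⟨a, m, hm, ham⟩ := Nat.exists_eq_pow_mul_and_not_dvd (orderOf_pos g).ne' q hq.ne_one
  have hcop : IsCoprime (m : ℤ) ((q ^ k : ℕ) : ℤ) := by
    rw [Nat.isCoprime_iff_coprime]
    exact Nat.Coprime.pow_right _ ((hq.coprime_iff_not_dvd.2 hm).symm)
  obtain ⟨u, v, huv⟩ := hcop
  refine ⟨(g ^ m) ^ u, PEl.zpow ⟨a, ?_⟩ u, ?_⟩
  · rw [← pow_mul, mul_comm, ← ham, pow_orderOf_eq_one]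
  · rw [map_zpow, map_pow, ← zpow_natCast, ← zpow_mul]
    have : (m : ℤ) * u = 1 - (q ^ k : ℕ) * v := by linarith
    rw [this, zpow_sub, zpow_mul, zpow_natCast, hk]
    simp

theorem StarC.image [Finite G] {H : Type*} [Group H] (h : StarC σ G) (f : G →* H)
    (hf : Function.Surjective f) : StarC σ H := by
  intro i M N hM hN hMN hi A hMA hAN q hq hqi x hx a ha
  obtain ⟨y, hy, rfl⟩ := pel_lift f hf hq hx
  obtain ⟨b, rfl⟩ := hf a
  have := h i (M.comap f) (N.comap f) inferInstance inferInstance (Subgroup.comap_mono hMN)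
    (by rwa [Subgroup.relIndex_comap, Subgroup.map_comap_eq_self_of_surjective hf])
    (A.comap f) (Subgroup.comap_mono hMA) (Subgroup.comap_mono hAN) q hq hqi y hy b ha
  simpa using this

theorem primesIn_sup {S : Set ℕ} {M N : Subgroup G} (hM : M.Normal)
    (hS : PrimesIn S (Nat.card M)) (hS' : PrimesIn S (Nat.card N)) :
    PrimesIn S (Nat.card (M ⊔ N : Subgroup G)) := by
  have : Nat.card M * M.relIndex N = Nat.card (M ⊔ N : Subgroup G) := by
    rw [← Subgroup.relIndex_sup_left, ← Subgroup.relIndex_bot_left, ← Subgroup.relIndex_bot_left]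
    exact Subgroup.relIndex_mul_relIndex _ _ _ bot_le le_sup_left
  rw [← this]
  exact hS.mul (hS'.of_dvd (Subgroup.relIndex_dvd_card _ _))

theorem exists_OS [Finite G] (S : Set ℕ) : ∃ F : Subgroup G, F.Characteristic ∧
    PrimesIn S (Nat.card F) ∧ ∀ N : Subgroup G, N.Normal → PrimesIn S (Nat.card N) → N ≤ F := by
  obtain ⟨F, hF⟩ := (Set.toFinite {N : Subgroup G | N.Normal ∧ PrimesIn S (Nat.card N)}).exists_maximal
    ⟨⊥, inferInstance, by simpa using primesIn_one S⟩
  have hmax : ∀ N : Subgroup G, N.Normal → PrimesIn S (Nat.card N) → N ≤ F := by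
    intro N hN hS
    haveI := hF.1.1
    exact le_sup_right.trans (hF.2 (y := F ⊔ N) ⟨inferInstance, primesIn_sup hF.1.1 hF.1.2 hS⟩ le_sup_left)
  refine ⟨F, ?_, hF.1.2, hmax⟩
  rw [Subgroup.characteristic_iff_map_le]
  intro φ
  apply hmax _ (hF.1.1.map _ φ.surjective)
  rw [← Nat.card_congr (F.equivMapOfInjective φ.toMonoidHom φ.injective).toEquiv]
  exact hF.1.2

theorem SS.extension {L : Subgroup G} [hL : L.Normal] {i : ι} (hi : PrimesIn (σ i) (Nat.card L))
    (h : SS σ (G ⧸ L)) : SS σ G := by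
  intro M hM hMt
  by_cases hLM : L ≤ M
  · have hs := QuotientGroup.mk'_surjective L
    have hcm : (M.map (QuotientGroup.mk' L)).comap (QuotientGroup.mk' L) = M := by
      rw [Subgroup.comap_map_eq, QuotientGroup.ker_mk']; exact sup_eq_left.2 hLM
    obtain ⟨N, hN, hMN, j, hj⟩ := h (M.map (QuotientGroup.mk' L)) (hM.map _ hs) (by
      intro hc
      rw [hc] at hcm
      exact hMt (by rw [← hcm]; simp))
    refine ⟨N.comap (QuotientGroup.mk' L), inferInstance, ?_, j, ?_⟩
    · rw [← hcm]
      refine lt_of_le_of_ne (Subgroup.comap_mono hMN.le) fun he => hMN.ne ?_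
      exact Subgroup.comap_injective hs he
    · rw [← hcm, Subgroup.relIndex_comap, Subgroup.map_comap_eq_self_of_surjective hs]
      exact hj
  · refine ⟨M ⊔ L, inferInstance, ?_, i, ?_⟩
    · exact lt_of_le_of_ne le_sup_left fun h => hLM (by rw [h]; exact le_sup_right)
    · rw [Subgroup.relIndex_sup_left]
      exact hi.of_dvd (Subgroup.relIndex_dvd_card _ _)

theorem SS.exists_normal [Nontrivial G] (h : SS σ G) : ∃ L : Subgroup G, L.Normal ∧ L ≠ ⊥ ∧
    ∃ i, PrimesIn (σ i) (Nat.card L) := by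
  obtain ⟨N, hN, hlt, i, hi⟩ := h ⊥ inferInstance bot_ne_top
  exact ⟨N, hN, hlt.ne', i, by rwa [Subgroup.relIndex_bot_left] at hi⟩

theorem SS.exists_hall (hσ : SigmaPartition σ) (j : ι) (n : ℕ) :
    ∀ (G : Type*) [Group G] [Finite G], Nat.card G = n → SS σ G →
    ∃ H : Subgroup G, IsHallSubgroup (σ j) H := by
  induction n using Nat.strong_induction_on with
  | _ n ih =>
    intro G _ _ hn hS
    by_cases hnt : Nontrivial G
    swap
    · rw [not_nontrivial_iff_subsingleton] at hnt
      refine ⟨⊥, ?_, ?_⟩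
      · simpa [PrimesIn] using primesIn_one (σ j)
      · intro p hp hd
        have : (⊥ : Subgroup G).index = 1 := by rw [Subgroup.index_bot]; exact Nat.card_unique
        rw [this] at hd
        exact absurd (Nat.dvd_one.1 hd) hp.ne_one
    obtain ⟨L, hL, hLb, i, hi⟩ := hS.exists_normal
    have hs := QuotientGroup.mk'_surjective L
    have hcard : Nat.card G = Nat.card (G ⧸ L) * Nat.card L := Subgroup.card_eq_card_quotient_mul_card_subgroup L
    have hL1 : 1 < Nat.card L := by
      have := Nat.card_pos (α := L)
      have h2 : Nat.card L ≠ 1 := fun h => hLb (Subgroup.card_eq_one.1 h)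
      omega
    have hlt : Nat.card (G ⧸ L) < n := by
      rw [← hn, hcard]
      exact lt_mul_of_one_lt_right Nat.card_pos hL1
    obtain ⟨H, hH1, hH2⟩ := ih _ hlt (G ⧸ L) rfl (hS.image _ hs)
    set H' := H.comap (QuotientGroup.mk' L) with hH'
    have hLH : L ≤ H' := by
      rw [hH']; intro x hx
      rw [Subgroup.mem_comap, QuotientGroup.mk'_apply, (QuotientGroup.eq_one_iff x).2 hx]
      exact one_mem _
    have hidx : H'.index = H.index := Subgroup.index_comap_of_surjective _ hs
    have hrel : L.relIndex H' = Nat.card H := by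
      have : L = (⊥ : Subgroup (G ⧸ L)).comap (QuotientGroup.mk' L) := by
        rw [MonoidHom.comap_bot, QuotientGroup.ker_mk']
      conv_lhs => rw [this]
      rw [Subgroup.relIndex_comap, hH', Subgroup.map_comap_eq_self_of_surjective hs, Subgroup.relIndex_bot_left]
    have hc : Nat.card H' = Nat.card L * Nat.card H := by
      rw [← hrel, ← Subgroup.relIndex_bot_left, ← Subgroup.relIndex_bot_left]
      exact (Subgroup.relIndex_mul_relIndex _ _ _ bot_le hLH).symm
    by_cases hij : i = j
    · subst hij
      exact ⟨H', by rw [hc]; exact hi.mul hH1, by rw [hidx]; exact hH2⟩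
    · have hcop : Nat.Coprime (Nat.card (L.subgroupOf H')) (L.subgroupOf H').index := by
        rw [Nat.card_congr (Subgroup.subgroupOfEquivOfLe hLH).toEquiv]
        change Nat.Coprime _ (L.relIndex H')
        rw [hrel]
        exact coprime_of_primesIn hi hH1 (sp_disj hσ hij)
      obtain ⟨K, hK⟩ := Subgroup.exists_right_complement'_of_coprime hcop
      have hKc : Nat.card K = Nat.card H := by
        rw [← hrel]; exact hK.symm.index_eq_card.symm
      have hKc' : Nat.card (K.map H'.subtype) = Nat.card H := by
        rw [← hKc]
        exact (Nat.card_congr (K.equivMapOfInjective _ H'.subtype_injective).toEquiv).symm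
      refine ⟨K.map H'.subtype, by rw [hKc']; exact hH1, ?_⟩
      have hKi : (K.map H'.subtype).index = Nat.card L * H'.index := by
        have h1 := (K.map H'.subtype).card_mul_index
        have h2 := H'.card_mul_index
        rw [hKc'] at h1
        rw [hc] at h2
        have : 0 < Nat.card H := Nat.card_pos
        apply Nat.eq_of_mul_eq_mul_left this
        rw [h1, ← h2]; ring
      intro p hp hd
      rw [hKi, hidx] at hd
      rcases hp.dvd_mul.1 hd with hd | hd
      · exact fun hpj => hij (sp_eq hσ (hi p hp hd) hpj)
      · exact hH2 p hp hd

theorem SS.hall [Finite G] (h : SS σ G) (hσ : SigmaPartition σ) (j : ι) :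
    ∃ H : Subgroup G, IsHallSubgroup (σ j) H := SS.exists_hall hσ j _ G rfl h

theorem SS.completeHall [Finite G] (h : SS σ G) (hσ : SigmaPartition σ) :
    ∃ ℋ : Set (Subgroup G), CompleteHallSigmaSet σ G ℋ ∧
      ∀ H ∈ ℋ, ∃ i, IsHallSubgroup (σ i) H := by
  choose f hf using h.hall hσ
  refine ⟨Set.range f, ⟨?_, ?_⟩, ?_⟩
  · rintro _ ⟨i, rfl⟩ -
    exact ⟨i, hf i⟩
  · rintro i ⟨p, hp, hpi, hpG⟩
    refine ⟨f i, ⟨⟨i, rfl⟩, hf i⟩, ?_⟩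
    rintro _ ⟨⟨j, rfl⟩, hj⟩
    have hd : p ∣ Nat.card (f j) := by
      rw [← (f j).card_mul_index] at hpG
      exact (hp.dvd_mul.1 hpG).resolve_right fun h => hj.2 p hp h hpi
    rw [sp_eq hσ hpi ((hf j).1 p hp hd)]
  · rintro _ ⟨i, rfl⟩
    exact ⟨i, hf i⟩
end ssbasic

open scoped Pointwise

section pd
variable {ι : Type*} {σ : ι → Set ℕ} {G : Type*} [Group G]

theorem conj_into_of_not_dvd_index [Finite G] {q : ℕ} (hq : q.Prime) {Q H : Subgroup G}
    (hQ : IsPGroup q Q) (hH : ¬ q ∣ H.index) : ∃ g : G, ∀ x ∈ Q, g⁻¹ * x * g ∈ H := by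
  haveI := Fact.mk hq
  have h1 : ¬ q ∣ Nat.card (G ⧸ H) := hH
  obtain ⟨y, hy⟩ := hQ.nonempty_fixed_point_of_prime_not_dvd_card (G ⧸ H) h1
  obtain ⟨g, rfl⟩ := QuotientGroup.mk_surjective y
  refine ⟨g, fun x hx => ?_⟩
  have h2 := hy ⟨x⁻¹, Q.inv_mem hx⟩
  change ((x⁻¹ * g : G) : G ⧸ H) = (g : G ⧸ H) at h2
  rw [QuotientGroup.eq] at h2
  have : (x⁻¹ * g)⁻¹ * g = g⁻¹ * x * g := by group
  rwa [this] at h2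

theorem card_conj (H : Subgroup G) (x : G) :
    Nat.card (H.map (MulAut.conj x).toMonoidHom) = Nat.card H :=
  (Nat.card_congr (H.equivMapOfInjective _ (MulAut.conj x).injective).toEquiv).symm

theorem index_conj (H : Subgroup G) (x : G) :
    (H.map (MulAut.conj x).toMonoidHom).index = H.index :=
  Subgroup.index_map_equiv H (MulAut.conj x)

theorem IsHallSubgroup.conj {S : Set ℕ} {H : Subgroup G} (h : IsHallSubgroup S H) (x : G) :
    IsHallSubgroup S (H.map (MulAut.conj x).toMonoidHom) := by
  unfold IsHallSubgroup
  rw [card_conj, index_conj]; exact h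

theorem mul_sub_of_le {A H : Subgroup G} (h : H ≤ A) : (A : Set G) * (H : Set G) = A := by
  ext g; constructor
  · rintro ⟨a, ha, b, hb, rfl⟩
    exact A.mul_mem ha (h hb)
  · intro hg
    exact ⟨g, hg, 1, H.one_mem, mul_one g⟩

theorem sub_mul_of_le {A H : Subgroup G} (h : H ≤ A) : (H : Set G) * (A : Set G) = A := by
  ext g; constructor
  · rintro ⟨a, ha, b, hb, rfl⟩
    exact A.mul_mem (h ha) hb
  · intro hg
    exact ⟨1, H.one_mem, g, hg, one_mul g⟩

theorem normal_sigmaPermutable [Finite G] (hσ : SigmaPartition σ) (h : SS σ G) {N : Subgroup G}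
    (hN : N.Normal) : SigmaPermutable σ N := by
  obtain ⟨ℋ, hc, -⟩ := h.completeHall hσ
  refine ⟨ℋ, hc, fun H _ x => ?_⟩
  rw [← Subgroup.normal_mul, ← Subgroup.mul_normal, sup_comm]

theorem over_sigmaPermutable [Finite G] (hσ : SigmaPartition σ) (h : SS σ G) {M A : Subgroup G}
    (hM : M.Normal) {i : ι} (hi : PrimesIn (σ i) M.index) (hMA : M ≤ A) : SigmaPermutable σ A := by
  obtain ⟨ℋ, hc, hh⟩ := h.completeHall hσ
  refine ⟨ℋ, hc, fun H hH x => ?_⟩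
  obtain ⟨j, hj⟩ := hh H hH
  have hj' := hj.conj x
  set Y := H.map (MulAut.conj x).toMonoidHom
  by_cases hij : i = j
  · subst hij
    have ht : Y ⊔ M = ⊤ := by
      rw [← Subgroup.index_eq_one]
      refine eq_one_of_primesIn (S := σ i) (S' := (σ i)ᶜ)
        (hi.of_dvd (Subgroup.index_dvd_of_le le_sup_right)) ?_ (fun p _ h h' => h' h)
      intro p hp hd
      exact hj'.2 p hp (hd.trans (Subgroup.index_dvd_of_le le_sup_left))
    have h1 : (Y : Set G) * (M : Set G) = Set.univ := by
      rw [← Subgroup.mul_normal, ht]; rfl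
    have h2 : (M : Set G) * (Y : Set G) = Set.univ := by
      rw [← Subgroup.normal_mul, sup_comm, ht]; rfl
    rw [Set.eq_univ_of_univ_subset (h1.symm.le.trans (Set.mul_subset_mul_left hMA)),
      Set.eq_univ_of_univ_subset (h2.symm.le.trans (Set.mul_subset_mul_right hMA))]
  · have hle : Y ≤ A := by
      refine le_trans ?_ hMA
      rw [← Subgroup.relIndex_eq_one]
      refine eq_one_of_primesIn (S := σ i) (S' := σ j) (hi.of_dvd ?_)
        (PrimesIn.of_dvd hj'.1 (Subgroup.relIndex_dvd_card _ _)) (sp_disj hσ hij)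
      rw [← Subgroup.relIndex_top_right]
      exact relIndex_dvd_of_normal le_top hM
    rw [mul_sub_of_le hle, sub_mul_of_le hle]

theorem IsPSigmaT.star [Finite G] (hσ : SigmaPartition σ) (h : SS σ G) (hT : IsPSigmaT σ G) :
    StarC σ G := by
  intro i M N hM hN hMN hi A hMA hAN q hq hqi x hx a ha
  by_cases hx1 : x = 1
  · subst hx1; simpa using ha
  have h1 : SigmaPermutable σ ((A.subgroupOf N).map N.subtype) := by
    apply hT N (normal_sigmaPermutable hσ h hN)
    haveI : (M.subgroupOf N).Normal := inferInstance
    exact over_sigmaPermutable hσ (h.subgroup N) (M := M.subgroupOf N) inferInstance (i := i) hi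
      (Subgroup.comap_mono hMA)
  rw [Subgroup.map_subgroupOf_eq_of_le hAN] at h1
  obtain ⟨ℋ, hc, hperm⟩ := h1
  obtain ⟨j, hqj⟩ := sp_ex hσ hq
  have hij : i ≠ j := fun e => hqi (e ▸ hqj)
  have hqG : q ∣ Nat.card G := by
    have := hx.dvd_card hq hx1 (Subgroup.mem_top x)
    rwa [Subgroup.card_top] at this
  obtain ⟨H, ⟨hHH, hHall⟩, -⟩ := hc.2 j ⟨q, hq, hqj, hqG⟩
  obtain ⟨g, hg⟩ := conj_into_of_not_dvd_index hq hx.zpowers_isPGroup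
    (fun hd => hHall.2 q hq hd hqj)
  have hj' := IsHallSubgroup.conj hHall g
  have hp := hperm H hHH g
  set Y := H.map (MulAut.conj g).toMonoidHom
  have hxY : x ∈ Y := ⟨_, hg x (Subgroup.mem_zpowers x), by simp [mul_assoc]⟩
  have h2 : x * a ∈ (A : Set G) * (Y : Set G) := by
    rw [hp]; exact ⟨x, hxY, a, ha, rfl⟩
  obtain ⟨a', ha', y, hy, he⟩ := h2
  have he' : a' * y = x * a := he
  have h3 : y * x⁻¹ = a'⁻¹ * (x * a * x⁻¹) := by rw [← he']; group
  have h4 : y * x⁻¹ ∈ N ⊓ Y := by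
    refine ⟨?_, Y.mul_mem hy (Y.inv_mem hxY)⟩
    rw [h3]
    exact N.mul_mem (N.inv_mem (hAN ha')) (hN.conj_mem a (hAN ha) x)
  have h5 : N ⊓ Y ≤ M := by
    rw [← Subgroup.relIndex_eq_one]
    refine eq_one_of_primesIn (S := σ i) (S' := σ j) (hi.of_dvd ?_)
      (PrimesIn.of_dvd hj'.1 ((Subgroup.relIndex_dvd_card _ _).trans
        (Subgroup.card_dvd_of_le inf_le_right))) (sp_disj hσ hij)
    exact relIndex_dvd_of_normal inf_le_left hM
  have h6 : x * a * x⁻¹ = a' * (y * x⁻¹) := by rw [h3]; group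
  rw [h6]
  exact A.mul_mem ha' (hMA (h5 h4))
end pd

open scoped Pointwise

section pe
variable {ι : Type*} {σ : ι → Set ℕ} {G : Type*} [Group G]

theorem exists_pel_of_dvd [Finite G] {p : ℕ} (hp : p.Prime) {H : Subgroup G}
    (h : p ∣ Nat.card H) : ∃ x ∈ H, PEl p x ∧ x ≠ 1 := by
  haveI := Fact.mk hp
  obtain ⟨x, hx⟩ := exists_prime_orderOf_dvd_card' (G := H) p h
  refine ⟨x, x.2, ⟨1, ?_⟩, ?_⟩
  · have := pow_orderOf_eq_one x
    rw [hx] at this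
    rw [pow_one]
    exact congrArg Subtype.val this
  · intro h1
    have : x = 1 := Subtype.ext h1
    rw [this, orderOf_one] at hx
    exact hp.ne_one hx.symm

theorem exists_pel_of_dvd' [Finite G] {p : ℕ} (hp : p.Prime) (h : p ∣ Nat.card G) :
    ∃ x : G, PEl p x ∧ x ≠ 1 := by
  obtain ⟨x, -, h⟩ := exists_pel_of_dvd hp (H := (⊤ : Subgroup G)) (by rwa [Subgroup.card_top])
  exact ⟨x, h⟩

/-- if `Z ≤ M` contains all `p`-elements of `M`, then `p` does not divide the index -/
theorem not_dvd_relIndex [Finite G] {p : ℕ} (hp : p.Prime) {Z M : Subgroup G}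
    (hn : ∀ z ∈ Z, z ∈ M → ∀ m ∈ M, m * z * m⁻¹ ∈ Z)
    (h : ∀ x ∈ M, PEl p x → x ∈ Z) : ¬ p ∣ Z.relIndex M := by
  intro hd
  haveI : (Z.subgroupOf M).Normal := ⟨fun z hz m => hn z hz z.2 m m.2⟩
  obtain ⟨x, hx, hx1⟩ := exists_pel_of_dvd' (G := M ⧸ Z.subgroupOf M) hp hd
  obtain ⟨y, hy, rfl⟩ := pel_lift (QuotientGroup.mk' (Z.subgroupOf M)) (QuotientGroup.mk'_surjective _) hp hx
  apply hx1
  rw [QuotientGroup.mk'_apply, QuotientGroup.eq_one_iff]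
  exact h y y.2 hy.coe

theorem central_hall_normal [Finite G] {M : Subgroup G} (hM : M.Normal) (Z : Subgroup G)
    (hZ : ∀ z ∈ Z, z ∈ M → ∀ m ∈ M, z * m = m * z)
    (hc : Nat.Coprime (Nat.card (Z ⊓ M : Subgroup G)) (Z.relIndex M)) :
    ∃ B : Subgroup G, B ≤ M ∧ B.Normal ∧ Nat.card B = Z.relIndex M ∧
      ∀ g, g ∈ B ↔ g ∈ M ∧ g ^ Z.relIndex M = 1 := by
  have hcard : Nat.card (Z.subgroupOf M) = Nat.card (Z ⊓ M : Subgroup G) := by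
    rw [← Subgroup.inf_subgroupOf_right]
    exact Nat.card_congr (Subgroup.subgroupOfEquivOfLe inf_le_right).toEquiv
  obtain ⟨B, hB, hBc⟩ := central_hall (Z.subgroupOf M)
    (fun z hz g => Subtype.ext (hZ z hz z.2 g g.2)) (by rw [hcard]; exact hc)
  have hmem : ∀ g, g ∈ B.map M.subtype ↔ g ∈ M ∧ g ^ Z.relIndex M = 1 := by
    intro g
    constructor
    · rintro ⟨b, hb, rfl⟩
      exact ⟨b.2, congrArg Subtype.val ((hB b).1 hb)⟩
    · rintro ⟨h1, h2⟩
      exact ⟨⟨g, h1⟩, (hB _).2 (Subtype.ext h2), rfl⟩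
  refine ⟨B.map M.subtype, Subgroup.map_subtype_le B, ⟨?_⟩, ?_, hmem⟩
  · intro b hb g
    rw [hmem] at hb ⊢
    refine ⟨hM.conj_mem b hb.1 g, ?_⟩
    rw [conj_pow, hb.2]; simp
  · rw [← Nat.card_congr (B.equivMapOfInjective _ M.subtype_injective).toEquiv, hBc]
    rfl

/-- the structure of a group generated by central torsion -/
theorem central_primes [Finite G] (S : Set ℕ)
    (h : ∀ p : ℕ, p.Prime → p ∉ S → ∀ x : G, PEl p x → ∀ y, x * y = y * x) :
    ∃ Z : Subgroup G, (∀ z ∈ Z, ∀ g, z * g = g * z) ∧ PrimesIn Sᶜ (Nat.card Z) ∧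
      PrimesIn S Z.index := by
  let Z : Subgroup G :=
    { carrier := {z | (∀ g, z * g = g * z) ∧ ∃ n : ℕ, PrimesIn Sᶜ n ∧ z ^ n = 1}
      mul_mem' := by
        rintro a b ⟨ha, n, hn, han⟩ ⟨hb, m, hm, hbm⟩
        refine ⟨fun g => by rw [mul_assoc, hb, ← mul_assoc, ha, mul_assoc], n * m, hn.mul hm, ?_⟩
        rw [(show Commute a b from ha b).mul_pow, pow_mul, han, mul_comm n m, pow_mul, hbm]
        simp
      one_mem' := ⟨fun g => by simp, 1, primesIn_one _, by simp⟩
      inv_mem' := by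
        rintro a ⟨ha, n, hn, han⟩
        refine ⟨fun g => ?_, n, hn, by rw [inv_pow, han, inv_one]⟩
        have := (show Commute a g from ha g).inv_left
        exact this }
  refine ⟨Z, fun z hz => hz.1, ?_, ?_⟩
  · intro p hp hd
    obtain ⟨x, hx, ⟨k, hk⟩, hx1⟩ := exists_pel_of_dvd hp hd
    obtain ⟨n, hn, hxn⟩ := hx.2
    by_contra hpn
    apply hx1
    have : Nat.Coprime (p ^ k) n := by
      refine Nat.Coprime.pow_left _ ((Nat.Prime.coprime_iff_not_dvd hp).2 fun hd => hpn (hn p hp hd))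
    have h1 := Nat.dvd_gcd (orderOf_dvd_of_pow_eq_one hk) (orderOf_dvd_of_pow_eq_one hxn)
    rw [this] at h1
    exact orderOf_eq_one_iff.1 (Nat.dvd_one.1 h1)
  · intro p hp hd
    by_contra hpS
    rw [← Subgroup.relIndex_top_right] at hd
    refine not_dvd_relIndex hp (Z := Z) (M := ⊤) ?_ ?_ hd
    · intro z hz _ m _
      rw [← hz.1 m]; simpa using hz
    · rintro x - ⟨k, hk⟩
      exact ⟨h p hp hpS x ⟨k, hk⟩, p ^ k, primesIn_pow hp hpS, hk⟩

theorem SS.centralizer_le [Finite G] (hσ : SigmaPartition σ) (hS : SS σ G) {i : ι}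
    {L : Subgroup G} (hL : L.Normal) (hi : PrimesIn (σ i) (Nat.card L))
    (hmax : ∀ N : Subgroup G, N.Normal → PrimesIn (σ i) (Nat.card N) → N ≤ L)
    (hF : ∀ j, j ≠ i → ∀ N : Subgroup G, N.Normal → PrimesIn (σ j) (Nat.card N) → N = ⊥) :
    Subgroup.centralizer (L : Set G) ≤ L := by
  by_contra hnot
  set C := Subgroup.centralizer (L : Set G) with hC
  haveI : C.Normal := inferInstance
  obtain ⟨N0, hN0⟩ := (Set.toFinite {N : Subgroup G | N.Normal ∧ N ⊓ C ≤ L}).exists_maximal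
    ⟨⊥, inferInstance, by simp⟩
  obtain ⟨N, hN, hlt, j, hj⟩ := hS N0 hN0.1.1 (by
    rintro rfl
    exact hnot (by simpa using hN0.1.2))
  have hM : ¬ N ⊓ C ≤ L := fun h => hlt.not_ge (hN0.2 (y := N) ⟨hN, h⟩ hlt.le)
  have hMn : (N ⊓ C).Normal := inferInstance
  set M := N ⊓ C with hMdef
  have hrel : PrimesIn (σ j) (L.relIndex M) := by
    refine hj.of_dvd ?_
    rw [← Subgroup.inf_relIndex_right]
    refine dvd_trans ?_ (relIndex_dvd_of_normal (H := N) (U := M) inf_le_left hN0.1.1)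
    rw [← Subgroup.inf_relIndex_right N0]
    refine Subgroup.relIndex_dvd_of_le_left _ (le_inf ?_ inf_le_right)
    exact le_trans (le_inf inf_le_left (inf_le_right.trans inf_le_right)) hN0.1.2
  by_cases hij : j = i
  · subst hij
    apply hM
    apply hmax M hMn
    have h1 : Nat.card (L ⊓ M : Subgroup G) * L.relIndex M = Nat.card M := by
      rw [← Subgroup.inf_relIndex_right, ← Subgroup.relIndex_bot_left, ← Subgroup.relIndex_bot_left]
      exact Subgroup.relIndex_mul_relIndex _ _ _ bot_le inf_le_right
    rw [← h1]
    exact (hi.of_dvd (Subgroup.card_dvd_of_le inf_le_left)).mul hrel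
  · obtain ⟨B, hBM, hBn, hBc, -⟩ := central_hall_normal hMn L
      (fun z hz _ m hm => Subgroup.mem_centralizer_iff.1 hm.2 z hz)
      (coprime_of_primesIn (hi.of_dvd (Subgroup.card_dvd_of_le inf_le_left)) hrel
        (sp_disj hσ (Ne.symm hij)))
    have hb := hF j hij B hBn (by rw [hBc]; exact hrel)
    rw [hb, Subgroup.card_bot] at hBc
    exact hM (Subgroup.relIndex_eq_one.1 hBc.symm)

theorem mono_structure [Finite G] (hσ : SigmaPartition σ) (hS : SS σ G) (hT : StarC σ G) {c : G}
    (hc : c ≠ 1) (hmono : ∀ N : Subgroup G, N.Normal → N ≠ ⊥ → c ∈ N) :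
    (∃ i, PrimesIn (σ i) (Nat.card G)) ∨ ∃ (r : ℕ) (k : ι) (R : Subgroup G), r.Prime ∧ r ∈ σ k ∧
      R.Normal ∧ IsPGroup r R ∧ (∀ a ∈ R, ∀ b ∈ R, a * b = b * a) ∧
      (∀ x y : G, x * y * x⁻¹ * y⁻¹ ∈ R) ∧
      ∀ p : ℕ, p.Prime → p ∈ σ k → ∀ x : G, PEl p x → x ∈ R := by
  haveI : Nontrivial G := ⟨c, 1, hc⟩
  obtain ⟨L0, hL0, hL0b, i, hi0⟩ := hS.exists_normal
  obtain ⟨L, hLch, hi, hmax⟩ := exists_OS (G := G) (σ i)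
  have hL : L.Normal := inferInstance
  have hLb : L ≠ ⊥ := fun h => hL0b (le_bot_iff.1 (h ▸ hmax L0 hL0 hi0))
  have hcL := hmono L hL hLb
  have hF : ∀ j, j ≠ i → ∀ N : Subgroup G, N.Normal → PrimesIn (σ j) (Nat.card N) → N = ⊥ := by
    intro j hj N hN hNj
    by_contra hb
    have hcN := hmono N hN hb
    have : orderOf c = 1 := eq_one_of_primesIn (hi.of_dvd (L.orderOf_dvd_natCard hcL))
      (hNj.of_dvd (N.orderOf_dvd_natCard hcN)) (sp_disj hσ (Ne.symm hj))
    exact hc (orderOf_eq_one_iff.1 this)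
  have hCL := hS.centralizer_le hσ hL hi hmax hF
  have hqL : ∀ q : ℕ, q.Prime → q ∉ σ i → ¬ q ∣ Nat.card L := fun q hq h hd => h (hi q hq hd)
  have hPA : ∀ q : ℕ, q.Prime → q ∉ σ i → ∀ x : G, PEl q x → PowAct x L := by
    intro q hq hqi x hx A hA a ha
    exact hT i ⊥ L inferInstance hL bot_le (by rwa [Subgroup.relIndex_bot_left]) A bot_le hA q hq
      hqi x hx a ha
  by_cases hall : ∀ q : ℕ, q.Prime → q ∉ σ i → ∀ x : G, PEl q x → ∀ h ∈ L, x * h = h * x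
  · left
    refine ⟨i, fun p hp hd => ?_⟩
    by_contra hpi
    obtain ⟨x, hx, hx1⟩ := exists_pel_of_dvd' hp hd
    have : x ∈ L := hCL (Subgroup.mem_centralizer_iff.2 fun h hh => (hall p hp hpi x hx h hh).symm)
    exact hpi (hi p hp (hx.dvd_card hp hx1 this))
  right
  push Not at hall
  obtain ⟨q, hq, hqi, x, hx, h0, hh0, hne0⟩ := hall
  have hr : ∃ r : ℕ, r.Prime ∧ ∃ h ∈ L, PEl r h ∧ x * h ≠ h * x := by
    by_contra hcon
    push Not at hcon
    have : L ≤ Subgroup.centralizer {x} := le_of_pel fun p hp y hy hpy =>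
      Subgroup.mem_centralizer_iff.2 fun z hz => by
        rw [Set.mem_singleton_iff.1 hz]; exact hcon p hp y hy hpy
    exact hne0 (Subgroup.mem_centralizer_iff.1 (this hh0) x rfl)
  obtain ⟨r, hr, h, hh, hrh, hne⟩ := hr
  have h1 : h ≠ 1 := by rintro rfl; simp at hne
  have hri : r ∈ σ i := hi r hr (hrh.dvd_card hr h1 hh)
  have hcent : ∀ e ∈ L, PEl r e → ∀ g ∈ L, e * g = g * e := by
    intro e he hre g hg
    by_cases hxe : x * e = e * x
    · rw [pw_fpf hq hr hx (hqL q hq hqi) (hPA q hq hqi x hx) hrh hh hne hre he hxe]; simp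
    · exact pw_central hq hr hx (hqL q hq hqi) (hPA q hq hqi x hx) hre he hxe g hg
  let R : Subgroup G :=
    { carrier := {e | e ∈ L ∧ PEl r e}
      mul_mem' := fun {a b} ha hb => ⟨L.mul_mem ha.1 hb.1,
        ha.2.mul_of_comm hb.2 (hcent a ha.1 ha.2 b hb.1)⟩
      one_mem' := ⟨L.one_mem, 0, by simp⟩
      inv_mem' := fun {a} ha => ⟨L.inv_mem ha.1, ha.2.inv⟩ }
  have hRL : R ≤ L := fun a ha => ha.1
  have hRn : R.Normal := ⟨fun a ha g => ⟨hL.conj_mem a ha.1 g, ha.2.conj g⟩⟩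
  have hRp : IsPGroup r R := isPGroup_of_pel fun a ha => ha.2
  have hRb : R ≠ ⊥ := fun hb => h1 (Subgroup.mem_bot.1 (hb ▸ (⟨hh, hrh⟩ : h ∈ R)))
  have hnd : ¬ r ∣ R.relIndex L := not_dvd_relIndex hr (fun z hz _ m _ => hRn.conj_mem z hz m)
    (fun x hx hrx => ⟨hx, hrx⟩)
  have hLR : L ≤ R := by
    obtain ⟨B, hBL, hBn, hBc, hBm⟩ := central_hall_normal hL R
      (fun z hz _ m hm => hcent z hz.1 hz.2 m hm) (by
        rw [inf_eq_left.2 hRL]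
        refine coprime_of_primesIn (S := {r}) (S' := {r}ᶜ) (isPGroup_primesIn hr hRp rfl) ?_
          (fun p _ h h' => h' h)
        intro p hp hd hpr
        rw [Set.mem_singleton_iff.1 hpr] at hd
        exact hnd hd)
    by_cases hBb : B = ⊥
    · rw [hBb, Subgroup.card_bot] at hBc
      exact Subgroup.relIndex_eq_one.1 hBc.symm
    · exfalso
      obtain ⟨k, hk⟩ := (hmono R hRn hRb).2
      have h2 := ((hBm c).1 (hmono B hBn hBb)).2
      have : Nat.Coprime (r ^ k) (R.relIndex L) :=
        Nat.Coprime.pow_left _ ((Nat.Prime.coprime_iff_not_dvd hr).2 hnd)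
      have h3 := Nat.dvd_gcd (orderOf_dvd_of_pow_eq_one hk) (orderOf_dvd_of_pow_eq_one h2)
      rw [this] at h3
      exact hc (orderOf_eq_one_iff.1 (Nat.dvd_one.1 h3))
  have hab : ∀ a ∈ L, ∀ b ∈ L, a * b = b * a := fun a ha b hb => hcent a ha (hLR ha).2 b hb
  have hcomm : ∀ q : ℕ, q.Prime → q ∉ σ i → ∀ x : G, PEl q x → ∀ y, (y * x)⁻¹ * (x * y) ∈ L := by
    intro q hq hqi x hx y
    apply hCL
    rw [Subgroup.mem_centralizer_iff]
    intro a ha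
    have := pw_univ hq hr (fun e => hqi (e ▸ hri)) hx hL (hPA q hq hqi x hx) hab ha (hLR ha).2 y
    have e1 : (x * y) * a * (x * y)⁻¹ = (y * x) * a * (y * x)⁻¹ := by
      simpa [mul_assoc] using this
    have e2 : (x * y) * a = (y * x) * a * (y * x)⁻¹ * (x * y) := by
      rw [← e1]; group
    rw [mul_assoc ((y * x)⁻¹), e2]
    group
  have hs := QuotientGroup.mk'_surjective L
  obtain ⟨Z, hZc, hZ1, hZ2⟩ := central_primes (G := G ⧸ L) (σ i) (by
    intro p hp hpi xb hxb yb
    obtain ⟨x, hx, rfl⟩ := pel_lift (QuotientGroup.mk' L) hs hp hxb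
    obtain ⟨y, rfl⟩ := hs yb
    rw [← map_mul, ← map_mul]
    exact (QuotientGroup.eq.2 (hcomm p hp hpi x hx y)).symm)
  obtain ⟨B, hBm, hBc⟩ := central_hall Z hZc (coprime_of_primesIn hZ1 hZ2 (fun p _ h h' => h h'))
  have hBn : B.Normal := ⟨fun b hb g => by
    rw [hBm] at hb ⊢
    rw [conj_pow, hb]; simp⟩
  have hBL : B.comap (QuotientGroup.mk' L) ≤ L := by
    apply hmax _ inferInstance
    have hLB : L ≤ B.comap (QuotientGroup.mk' L) := by
      intro x hx
      rw [Subgroup.mem_comap, QuotientGroup.mk'_apply, (QuotientGroup.eq_one_iff x).2 hx]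
      exact one_mem _
    have hrel : L.relIndex (B.comap (QuotientGroup.mk' L)) = Nat.card B := by
      have : L = (⊥ : Subgroup (G ⧸ L)).comap (QuotientGroup.mk' L) := by
        rw [MonoidHom.comap_bot, QuotientGroup.ker_mk']
      conv_lhs => enter [1]; rw [this]
      rw [Subgroup.relIndex_comap, Subgroup.map_comap_eq_self_of_surjective hs, Subgroup.relIndex_bot_left]
    have hcd : Nat.card (B.comap (QuotientGroup.mk' L)) = Nat.card L * Nat.card B := by
      rw [← hrel, ← Subgroup.relIndex_bot_left, ← Subgroup.relIndex_bot_left]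
      exact (Subgroup.relIndex_mul_relIndex _ _ _ bot_le hLB).symm
    rw [hcd, hBc]
    exact hi.mul hZ2
  have hBb : B = ⊥ := by
    rw [eq_bot_iff]
    intro b hb
    obtain ⟨y, rfl⟩ := hs b
    exact Subgroup.mem_bot.2 ((QuotientGroup.eq_one_iff y).2 (hBL hb))
  have hZt : Z = ⊤ := by
    rw [hBb, Subgroup.card_bot] at hBc
    exact Subgroup.index_eq_one.1 hBc.symm
  refine ⟨r, i, L, hr, hri, hL, isPGroup_of_pel fun a ha => (hLR ha).2, hab, ?_, ?_⟩
  · intro x y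
    have := hZc (x : G ⧸ L) (hZt ▸ Subgroup.mem_top _) (y : G ⧸ L)
    rw [← QuotientGroup.eq_one_iff]
    change (x : G ⧸ L) * y * (x : G ⧸ L)⁻¹ * (y : G ⧸ L)⁻¹ = 1
    rw [this]; group
  · intro p hp hpi x hx
    by_contra hxL
    have h2 : ((x : G ⧸ L)) ≠ 1 := fun h => hxL ((QuotientGroup.eq_one_iff x).1 h)
    exact hZ1 p hp ((hx.map (QuotientGroup.mk' L)).dvd_card hp h2 (hZt ▸ Subgroup.mem_top _)) hpi
end pe

open scoped Pointwise

section pf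
variable {ι : Type*} {σ : ι → Set ℕ} {G : Type*} [Group G]

theorem exists_mono [Finite G] {v : G} (hv : v ≠ 1) : ∃ M : Subgroup G, M.Normal ∧ v ∉ M ∧
    ∀ N : Subgroup G, N.Normal → M < N → v ∈ N := by
  obtain ⟨M, hM⟩ := (Set.toFinite {N : Subgroup G | N.Normal ∧ v ∉ N}).exists_maximal
    ⟨⊥, inferInstance, by simpa using hv⟩
  refine ⟨M, hM.1.1, hM.1.2, fun N hN hlt => ?_⟩
  by_contra hvN
  exact hlt.not_ge (hM.2 (y := N) ⟨hN, hvN⟩ hlt.le)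

theorem mono_alt [Finite G] (hσ : SigmaPartition σ) (hS : SS σ G) (hT : StarC σ G) {v : G}
    (hv : v ≠ 1) : ∃ M : Subgroup G, M.Normal ∧ v ∉ M ∧
      ((∃ i, ∀ p : ℕ, p.Prime → p ∉ σ i → ∀ x : G, PEl p x → x ∈ M) ∨
      ∃ (r : ℕ) (k : ι) (R : Subgroup G), r.Prime ∧ r ∈ σ k ∧ R.Normal ∧
        (∀ x ∈ R, ∃ n : ℕ, x ^ r ^ n ∈ M) ∧ (∀ a ∈ R, ∀ b ∈ R, a * b * a⁻¹ * b⁻¹ ∈ M) ∧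
        (∀ x y : G, x * y * x⁻¹ * y⁻¹ ∈ R) ∧
        ∀ p : ℕ, p.Prime → p ∈ σ k → ∀ x : G, PEl p x → x ∈ R) := by
  obtain ⟨M, hM, hvM, hmono⟩ := exists_mono hv
  refine ⟨M, hM, hvM, ?_⟩
  have hs := QuotientGroup.mk'_surjective M
  rcases mono_structure (G := G ⧸ M) hσ (hS.image _ hs) (hT.image _ hs) (c := (v : G ⧸ M))
    (fun h => hvM ((QuotientGroup.eq_one_iff v).1 h)) (by
      intro N hN hNb
      change v ∈ N.comap (QuotientGroup.mk' M)
      apply hmono _ inferInstance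
      have hker : (⊥ : Subgroup (G ⧸ M)).comap (QuotientGroup.mk' M) = M := by
        rw [MonoidHom.comap_bot, QuotientGroup.ker_mk']
      refine lt_of_le_of_ne ?_ ?_
      · conv_lhs => rw [← hker]
        exact Subgroup.comap_mono bot_le
      · intro he
        apply hNb
        apply Subgroup.comap_injective hs
        rw [← he, hker]) with ⟨i, hi⟩ | ⟨r, k, R, hr, hrk, hRn, hRp, hRab, hcR, hRk⟩
  · left
    refine ⟨i, fun p hp hpi x hx => ?_⟩
    by_contra hxM
    have h2 : ((x : G ⧸ M)) ≠ 1 := fun h => hxM ((QuotientGroup.eq_one_iff x).1 h)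
    have := (hx.map (QuotientGroup.mk' M)).dvd_card hp h2 (Subgroup.mem_top _)
    rw [Subgroup.card_top] at this
    exact hpi (hi p hp this)
  · right
    refine ⟨r, k, R.comap (QuotientGroup.mk' M), hr, hrk, inferInstance, ?_, ?_, ?_, ?_⟩
    · intro x hx
      obtain ⟨n, hn⟩ := isPGroup_pel hRp hx
      exact ⟨n, (QuotientGroup.eq_one_iff _).1 hn⟩
    · intro a ha b hb
      rw [← QuotientGroup.eq_one_iff]
      have := hRab _ ha _ hb
      change (a : G ⧸ M) * b * (a : G ⧸ M)⁻¹ * (b : G ⧸ M)⁻¹ = 1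
      change (a : G ⧸ M) * b = (b : G ⧸ M) * a at this
      rw [this]; group
    · intro x y
      exact hcR (x : G ⧸ M) (y : G ⧸ M)
    · intro p hp hpk x hx
      exact hRk p hp hpk _ (hx.map (QuotientGroup.mk' M))

theorem mem_of_pow_mem {r t : ℕ} (hr : r.Prime) (ht : t.Prime) (hne : r ≠ t) {u : G}
    (hu : PEl t u) {M : Subgroup G} {n : ℕ} (h : u ^ r ^ n ∈ M) : u ∈ M := by
  obtain ⟨l, hl⟩ := zpow_gen ht hu (n := ((r ^ n : ℕ) : ℤ)) (by
    intro hd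
    exact not_dvd_prime_pow hr ht hne n (by exact_mod_cast hd))
  rw [hl, zpow_natCast]
  exact M.zpow_mem h l

theorem comm_mem_left {M : Subgroup G} (hM : M.Normal) {a : G} (ha : a ∈ M) (b : G) :
    a * b * a⁻¹ * b⁻¹ ∈ M := by
  have := M.mul_mem ha (hM.conj_mem _ (M.inv_mem ha) b)
  simpa [mul_assoc] using this

theorem comm_mem_right {M : Subgroup G} (hM : M.Normal) {b : G} (hb : b ∈ M) (a : G) :
    a * b * a⁻¹ * b⁻¹ ∈ M := M.mul_mem (hM.conj_mem b hb a) (M.inv_mem hb)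

theorem normal_zpowers_of_pel [Finite G] {e : G}
    (h : ∀ s : ℕ, s.Prime → ∀ g : G, PEl s g → g * e * g⁻¹ ∈ Subgroup.zpowers e) :
    (Subgroup.zpowers e).Normal := by
  have : (⊤ : Subgroup G) ≤ Subgroup.normalizer (Subgroup.zpowers e : Set G) := by
    apply le_of_pel
    intro s hs g _ hg
    apply Subgroup.mem_normalizer_fintype
    intro n hn
    obtain ⟨l, rfl⟩ := Subgroup.mem_zpowers_iff.1 hn
    rw [← conj_zpow]
    exact Subgroup.zpow_mem _ (h s hs g hg) l
  exact Subgroup.normalizer_eq_top_iff.1 (top_le_iff.1 this)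

theorem lemmaE [Finite G] (hσ : SigmaPartition σ) (hS : SS σ G) (hT : StarC σ G) {i j : ι}
    (hij : i ≠ j) {p q : ℕ} (hp : p.Prime) (hq : q.Prime) (hpi : p ∈ σ i) (hqj : q ∈ σ j)
    {a b : G} (ha : PEl p a) (hb : PEl q b) {e : G} (he : e ∈ Subgroup.zpowers (a * b * a⁻¹ * b⁻¹))
    {r : ℕ} (hr : r.Prime) (hre : PEl r e) : (Subgroup.zpowers e).Normal := by
  obtain ⟨k, hrk⟩ := sp_ex hσ hr
  have case1 : ∀ M : Subgroup G, M.Normal →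
      (∃ i, ∀ p : ℕ, p.Prime → p ∉ σ i → ∀ x : G, PEl p x → x ∈ M) → e ∈ M := by
    rintro M hM ⟨l, hl⟩
    refine (Subgroup.zpowers_le.2 ?_) he
    by_cases hpl : p ∈ σ l
    · have hql : q ∉ σ l := fun h => hij ((sp_eq hσ hpi hpl).trans (sp_eq hσ h hqj))
      exact comm_mem_right hM (hl q hq hql b hb) a
    · exact comm_mem_left hM (hl p hp hpl a ha) b
  apply normal_zpowers_of_pel
  intro s hs g hg
  by_cases hsk : s ∈ σ k
  · have : g * e = e * g := by
      by_contra hne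
      have hv : g * e * g⁻¹ * e⁻¹ ≠ 1 := by
        intro h
        apply hne
        calc g * e = (g * e * g⁻¹ * e⁻¹) * (e * g) := by group
          _ = e * g := by rw [h, one_mul]
      obtain ⟨M, hM, hvM, h1 | ⟨r', k', R, hr', hrk', hRn, hRp, hRab, hcR, hRk⟩⟩ :=
        mono_alt hσ hS hT hv
      · exact hvM (comm_mem_right hM (case1 M hM h1) g)
      · have heR : e ∈ R := (Subgroup.zpowers_le.2 (hcR a b)) he
        by_cases hk : k' = k
        · subst hk
          exact hvM (hRab g (hRk s hs hsk g hg) e heR)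
        · obtain ⟨n, hn⟩ := hRp e heR
          refine hvM (comm_mem_right hM (mem_of_pow_mem hr' hr ?_ hre hn) g)
          rintro rfl
          exact hk (sp_eq hσ hrk' hrk)
    rw [this]; simp
  · have hN : PrimesIn {r} (Nat.card (Subgroup.normalClosure ({e} : Set G))) := by
      intro t ht hd
      by_contra htr
      obtain ⟨u, huN, hu, hu1⟩ := exists_pel_of_dvd ht hd
      have hle : ∀ M : Subgroup G, M.Normal → e ∈ M → u ∈ M := fun M hM h =>
        (Subgroup.normalClosure_le_normal (Set.singleton_subset_iff.2 h)) huN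
      obtain ⟨M, hM, hvM, h1 | ⟨r', k', R, hr', hrk', hRn, hRp, hRab, hcR, hRk⟩⟩ :=
        mono_alt hσ hS hT hu1
      · exact hvM (hle M hM (case1 M hM h1))
      · have heR : e ∈ R := (Subgroup.zpowers_le.2 (hcR a b)) he
        have huR := hle R hRn heR
        by_cases htr' : r' = t
        · obtain ⟨n, hn⟩ := hRp e heR
          refine hvM (hle M hM (mem_of_pow_mem hr' hr ?_ hre hn))
          rintro rfl
          exact htr htr'.symm
        · obtain ⟨n, hn⟩ := hRp u huR
          exact hvM (mem_of_pow_mem hr' ht htr' hu hn)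
    refine hT k ⊥ (Subgroup.normalClosure {e}) inferInstance inferInstance bot_le ?_
      (Subgroup.zpowers e) bot_le ?_ s hs hsk g hg e (Subgroup.mem_zpowers e)
    · rw [Subgroup.relIndex_bot_left]
      intro t ht hd
      rw [Set.mem_singleton_iff.1 (hN t ht hd)]; exact hrk
    · rw [Subgroup.zpowers_le]
      exact Subgroup.subset_normalClosure rfl

theorem lemmaE' [Finite G] (hσ : SigmaPartition σ) (hS : SS σ G) (hT : StarC σ G) {i j : ι}
    (hij : i ≠ j) {p q : ℕ} (hp : p.Prime) (hq : q.Prime) (hpi : p ∈ σ i) (hqj : q ∈ σ j)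
    {a b : G} (ha : PEl p a) (hb : PEl q b) : (Subgroup.zpowers (a * b * a⁻¹ * b⁻¹)).Normal := by
  apply normal_zpowers_of_pel
  intro s hs g hg
  have : Subgroup.zpowers (a * b * a⁻¹ * b⁻¹) ≤
      (Subgroup.zpowers (a * b * a⁻¹ * b⁻¹)).comap (MulAut.conj g).toMonoidHom := by
    apply le_of_pel
    intro r hr e he hre
    have := (lemmaE hσ hS hT hij hp hq hpi hqj ha hb he hr hre).conj_mem e (Subgroup.mem_zpowers e) g
    exact (Subgroup.zpowers_le.2 he) this
  exact this (Subgroup.mem_zpowers _)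

/-- core-free subgroups: elements of different classes commute -/
theorem core_free_comm [Finite G] (hσ : SigmaPartition σ) (hS : SS σ G) (hT : StarC σ G)
    {K : Subgroup G} (hK : K.normalCore = ⊥) {i j : ι}
    (hij : i ≠ j) {p q : ℕ} (hp : p.Prime) (hq : q.Prime) (hpi : p ∈ σ i) (hqj : q ∈ σ j)
    {a b : G} (haK : a ∈ K) (hbK : b ∈ K) (ha : PEl p a) (hb : PEl q b) : a * b = b * a := by
  have hn := lemmaE' hσ hS hT hij hp hq hpi hqj ha hb
  have h1 : Subgroup.zpowers (a * b * a⁻¹ * b⁻¹) ≤ K.normalCore := by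
    rw [Subgroup.normal_le_normalCore, Subgroup.zpowers_le]
    exact K.mul_mem (K.mul_mem (K.mul_mem haK hbK) (K.inv_mem haK)) (K.inv_mem hbK)
  rw [hK, Subgroup.zpowers_le, Subgroup.mem_bot] at h1
  calc a * b = (a * b * a⁻¹ * b⁻¹) * (b * a) := by group
    _ = b * a := by rw [h1, one_mul]
end pf

open scoped Pointwise

section pg
variable {ι : Type*} {σ : ι → Set ℕ} {G : Type*} [Group G]

/-- the subgroup generated by the `S`-elements of prime power order -/
def genS (S : Set ℕ) (K : Subgroup G) : Subgroup G :=
  Subgroup.closure {x | x ∈ K ∧ ∃ p : ℕ, p.Prime ∧ p ∈ S ∧ PEl p x}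

theorem genS_le (S : Set ℕ) (K : Subgroup G) : genS S K ≤ K :=
  (Subgroup.closure_le K).2 fun _ hx => hx.1

theorem mem_genS {S : Set ℕ} {K : Subgroup G} {p : ℕ} (hp : p.Prime) (hpS : p ∈ S) {x : G}
    (hx : x ∈ K) (h : PEl p x) : x ∈ genS S K := Subgroup.subset_closure ⟨hx, p, hp, hpS, h⟩

theorem genS_normal (S : Set ℕ) (K : Subgroup G) : ∀ k ∈ K, ∀ a ∈ genS S K,
    k * a * k⁻¹ ∈ genS S K := by
  intro k hk a ha
  have : genS S K ≤ (genS S K).comap (MulAut.conj k).toMonoidHom := by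
    refine (Subgroup.closure_le _).2 ?_
    rintro x ⟨hx, p, hp, hpS, h⟩
    exact mem_genS hp hpS (K.mul_mem (K.mul_mem hk hx) (K.inv_mem hk)) (h.conj k)
  exact this ha

theorem genS_primesIn [Finite G] (S : Set ℕ) (K : Subgroup G)
    (h : ∀ p q : ℕ, p.Prime → q.Prime → p ∈ S → q ∉ S → ∀ a ∈ K, ∀ b ∈ K, PEl p a → PEl q b →
      a * b = b * a) : PrimesIn S (Nat.card (genS S K)) := by
  obtain ⟨Z, hZc, hZ1, hZ2⟩ := central_primes (G := genS S K) S (by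
    intro q hq hqS x hx y
    have : genS S K ≤ Subgroup.centralizer {(x : G)} := by
      refine (Subgroup.closure_le _).2 ?_
      rintro a ⟨ha, p, hp, hpS, hpa⟩
      refine Subgroup.mem_centralizer_iff.2 fun z hz => ?_
      rw [Set.mem_singleton_iff.1 hz]
      exact (h p q hp hq hpS hqS a ha x (genS_le _ _ x.2) hpa hx.coe).symm
    exact Subtype.ext (Subgroup.mem_centralizer_iff.1 (this y.2) x rfl))
  obtain ⟨B, hBm, hBc⟩ := central_hall Z hZc (coprime_of_primesIn hZ1 hZ2 (fun p _ h h' => h h'))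
  have hBi : B.index = Nat.card Z := by
    have h1 := B.card_mul_index
    have h2 := Z.card_mul_index
    rw [hBc, ← h2, mul_comm] at h1
    exact Nat.eq_of_mul_eq_mul_right (Nat.pos_of_ne_zero Subgroup.index_ne_zero_of_finite) h1
  have hle : genS S K ≤ B.map (genS S K).subtype := by
    refine (Subgroup.closure_le _).2 ?_
    rintro a ⟨ha, p, hp, hpS, hpa⟩
    have ha' := mem_genS hp hpS ha hpa
    obtain ⟨g, hg⟩ := conj_into_of_not_dvd_index hp (hpa.mk ha').zpowers_isPGroup (H := B)
      (by rw [hBi]; exact fun hd => hZ1 p hp hd hpS)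
    have h1 := (hBm _).1 (hg _ (Subgroup.mem_zpowers _))
    have h2 : (g⁻¹ * ⟨a, ha'⟩ * g) = g⁻¹ * ⟨a, ha'⟩ * g⁻¹⁻¹ := by simp
    rw [h2, conj_pow] at h1
    refine ⟨⟨a, ha'⟩, (hBm _).2 ?_, rfl⟩
    have h3 := congrArg (fun t => g * t * g⁻¹) h1
    simpa [mul_assoc] using h3
  refine PrimesIn.of_dvd ?_ (Subgroup.card_dvd_of_le hle)
  rw [← Nat.card_congr (B.equivMapOfInjective _ (genS S K).subtype_injective).toEquiv, hBc]
  exact hZ2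

/-- relative permutability with Hall subgroups -/
def RP (σ : ι → Set ℕ) (K H : Subgroup G) : Prop :=
  ∀ j, ∃ Y ≤ H, PrimesIn (σ j) (Nat.card Y) ∧ PrimesIn (σ j)ᶜ (Y.relIndex H) ∧
    ∀ h ∈ H, ∀ k ∈ K, ∀ y ∈ Y, ∃ k' ∈ K, ∃ y' ∈ Y, (h * y * h⁻¹) * k = k' * (h * y' * h⁻¹)

theorem SigmaPermutable.rp [Finite G] {K : Subgroup G} (h : SigmaPermutable σ K) :
    RP σ K ⊤ := by
  obtain ⟨ℋ, hc, hperm⟩ := h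
  intro j
  by_cases hj : ∃ p : ℕ, p.Prime ∧ p ∈ σ j ∧ p ∣ Nat.card G
  · obtain ⟨Y, ⟨hY, hY'⟩, -⟩ := hc.2 j hj
    refine ⟨Y, le_top, hY'.1, ?_, ?_⟩
    · rw [Subgroup.relIndex_top_right]; exact hY'.2
    · intro h _ k hk y hy
      have h1 : (h * y * h⁻¹) * k ∈ (K : Set G) * (Y.map (MulAut.conj h).toMonoidHom : Set G) := by
        rw [hperm Y hY h]
        exact ⟨_, ⟨y, hy, rfl⟩, k, hk, rfl⟩
      obtain ⟨k', hk', _, ⟨y', hy', rfl⟩, he⟩ := h1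
      exact ⟨k', hk', y', hy', he.symm⟩
  · refine ⟨⊥, bot_le, ?_, ?_, ?_⟩
    · rw [Subgroup.card_bot]; exact primesIn_one _
    · rw [Subgroup.relIndex_bot_left, Subgroup.card_top]
      exact fun p hp hd hpj => hj ⟨p, hp, hpj, hd⟩
    · intro h _ k hk y hy
      refine ⟨k, hk, 1, Subgroup.one_mem _, ?_⟩
      rw [Subgroup.mem_bot.1 hy]; simp

theorem RP.map [Finite G] {G' : Type*} [Group G'] (f : G →* G') {K H : Subgroup G}
    (h : RP σ K H) : RP σ (K.map f) (H.map f) := by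
  intro j
  obtain ⟨Y, hYH, h1, h2, h3⟩ := h j
  refine ⟨Y.map f, Subgroup.map_mono hYH, h1.of_dvd (Subgroup.card_map_dvd Y f), h2.of_dvd ?_, ?_⟩
  · rw [← Subgroup.relIndex_comap]
    exact Subgroup.relIndex_dvd_of_le_left _ (Subgroup.le_comap_map _ _)
  · rintro _ ⟨h, hh, rfl⟩ _ ⟨k, hk, rfl⟩ _ ⟨y, hy, rfl⟩
    obtain ⟨k', hk', y', hy', he⟩ := h3 h hh k hk y hy
    refine ⟨f k', ⟨k', hk', rfl⟩, f y', ⟨y', hy', rfl⟩, ?_⟩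
    simpa using congrArg f he

theorem RP.step [Finite G] {K H A : Subgroup G} (h : RP σ K H) (hKH : K ≤ H)
    (hAK : A ≤ K) (hA : ∀ k ∈ K, ∀ a ∈ A, k * a * k⁻¹ ∈ A) {j : ι}
    (hj : PrimesIn (σ j) (Nat.card A)) : ∃ B : Subgroup G, A ≤ B ∧ B ≤ H ∧
      (∀ k ∈ H, ∀ b ∈ B, k * b * k⁻¹ ∈ B) ∧ PrimesIn (σ j) (Nat.card B) := by
  obtain ⟨Y, hYH, h1, h2, h3⟩ := h j
  have key : ∀ x ∈ H, ∀ a ∈ A, x⁻¹ * a * x ∈ Y := by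
    intro x hx
    let Y' := Y.map (MulAut.conj x).toMonoidHom
    have hY'H : Y' ≤ H := by
      rintro _ ⟨y, hy, rfl⟩
      exact H.mul_mem (H.mul_mem hx (hYH hy)) (H.inv_mem hx)
    have d1 : Y'.relIndex K ∣ Y'.relIndex H := by
      refine relIndex_dvd_of_perm hKH hY'H ?_
      rintro k hk _ ⟨y, hy, rfl⟩
      obtain ⟨k', hk', y', hy', he⟩ := h3 x hx k hk y hy
      exact ⟨k', hk', _, ⟨y', hy', rfl⟩, he⟩
    have d2 : (Y' ⊓ K).relIndex A ∣ (Y' ⊓ K).relIndex K :=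
      relIndex_dvd_of_normalizes hAK inf_le_right fun u hu v hv => hA v hv.2 u hu
    have e1 : (Y' ⊓ K).relIndex A = Y'.relIndex A := by
      rw [← Subgroup.inf_relIndex_right, inf_assoc, inf_eq_right.2 hAK, Subgroup.inf_relIndex_right]
    have e2 : Y'.relIndex H = Y.relIndex H := by
      have c1 := Subgroup.relIndex_mul_relIndex ⊥ Y' H bot_le hY'H
      have c2 := Subgroup.relIndex_mul_relIndex ⊥ Y H bot_le hYH
      rw [Subgroup.relIndex_bot_left, Subgroup.relIndex_bot_left] at c1 c2
      rw [show Nat.card Y' = Nat.card Y from card_conj Y x, ← c2] at c1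
      exact Nat.eq_of_mul_eq_mul_left Nat.card_pos c1
    rw [e1, Subgroup.inf_relIndex_right] at d2
    have : Y'.relIndex A = 1 := eq_one_of_primesIn
      (hj.of_dvd (Subgroup.relIndex_dvd_card _ _)) (h2.of_dvd (e2 ▸ d2.trans d1))
      (fun p _ h h' => h' h)
    intro a ha
    obtain ⟨y, hy, he⟩ := Subgroup.relIndex_eq_one.1 this ha
    have he' : x * y * x⁻¹ = a := he
    rw [← he']
    simpa [mul_assoc] using hy
  let B : Subgroup G :=
    { carrier := {g | ∀ x ∈ H, x⁻¹ * g * x ∈ Y}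
      mul_mem' := by
        intro a b ha hb x hx
        have := Y.mul_mem (ha x hx) (hb x hx)
        simpa [mul_assoc] using this
      one_mem' := by intro x hx; simp
      inv_mem' := by
        intro a ha x hx
        have := Y.inv_mem (ha x hx)
        simpa [mul_assoc] using this }
  have hBY : B ≤ Y := fun b hb => by simpa using hb 1 H.one_mem
  refine ⟨B, fun a ha x hx => key x hx a ha, hBY.trans hYH, ?_,
    h1.of_dvd (Subgroup.card_dvd_of_le hBY)⟩
  intro k hk b hb x hx
  have := hb (k⁻¹ * x) (H.mul_mem (H.inv_mem hk) hx)
  simpa [mul_assoc] using this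

theorem core_free_perm [Finite G] (hσ : SigmaPartition σ) (hS : SS σ G) (hT : StarC σ G)
    {K H : Subgroup G} (hcore : K.normalCore = ⊥) (hKH : K ≤ H) (h1 : RP σ K H) (h2 : RP σ H ⊤)
    {m : ι} {Y : Subgroup G} (hY : IsHallSubgroup (σ m) Y) :
    ∀ k ∈ K, ∀ y ∈ Y, ∃ y' ∈ Y, ∃ k' ∈ K, k * y = y' * k' := by
  have hC : ∀ j, ∃ C : Subgroup G, genS (σ j) K ≤ C ∧ C.Normal ∧ PrimesIn (σ j) (Nat.card C) := by
    intro j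
    have hj := genS_primesIn (σ j) K (by
      intro p q hp hq hpj hqj a ha b hb hpa hqb
      obtain ⟨i, hqi⟩ := sp_ex hσ hq
      exact core_free_comm hσ hS hT hcore (i := j) (j := i) (by rintro rfl; exact hqj hqi)
        hp hq hpj hqi ha hb hpa hqb)
    obtain ⟨B, hAB, hBH, hBn, hBj⟩ := h1.step hKH (genS_le _ _) (genS_normal _ _) hj
    obtain ⟨C, hBC, -, hCn, hCj⟩ := h2.step le_top hBH hBn hBj
    exact ⟨C, hAB.trans hBC, ⟨fun c hc g => hCn g trivial c hc⟩, hCj⟩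
  have key : K ≤ MulAction.stabilizer G ((Y : Set G) * (K : Set G)) := by
    apply le_of_pel
    intro p hp a ha hpa
    rw [MulAction.mem_stabilizer_set_iff_smul_set_subset (Set.toFinite _)]
    rintro _ ⟨_, ⟨y, hy, k, hk, rfl⟩, rfl⟩
    change a * (y * k) ∈ _
    obtain ⟨j, hpj⟩ := sp_ex hσ hp
    obtain ⟨C, hKC, hCn, hCj⟩ := hC j
    have haj := mem_genS hp hpj ha hpa
    by_cases hjm : j = m
    · subst hjm
      have hCY : C ≤ Y := by
        rw [← Subgroup.relIndex_eq_one]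
        refine eq_one_of_primesIn (S := σ j) (S' := (σ j)ᶜ)
          (hCj.of_dvd (Subgroup.relIndex_dvd_card _ _)) ?_ (fun p _ h h' => h' h)
        have := relIndex_dvd_of_normalizes (U := C) (V := Y) le_top le_top
          (fun u hu v _ => hCn.conj_mem u hu v)
        rw [Subgroup.relIndex_top_right] at this
        exact PrimesIn.of_dvd (n := Y.index) hY.2 this
      exact ⟨a * y, Y.mul_mem (hCY (hKC haj)) hy, k, hk, by simp [mul_assoc]⟩
    · have hN : Y ≤ Subgroup.normalizer (genS (σ j) K : Set G) := by
        apply le_of_pel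
        intro q hq z hz hqz
        by_cases hz1 : z = 1
        · rw [hz1]; exact Subgroup.one_mem _
        have hqm : q ∈ σ m := hY.1 q hq (hqz.dvd_card hq hz1 hz)
        apply Subgroup.mem_normalizer_fintype
        intro n hn
        exact hT j ⊥ C inferInstance hCn bot_le (by rwa [Subgroup.relIndex_bot_left])
          (genS (σ j) K) bot_le hKC q hq (fun h => hjm (sp_eq hσ h hqm)) z hqz n hn
      have h3 := (Subgroup.mem_normalizer_iff.1 (hN (Y.inv_mem hy)) a).1 haj
      refine ⟨y, hy, y⁻¹ * a * y⁻¹⁻¹ * k, K.mul_mem (genS_le _ _ h3) hk, ?_⟩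
      simp [mul_assoc]
  intro k hk y hy
  have h3 : k • ((Y : Set G) * (K : Set G)) = (Y : Set G) * (K : Set G) :=
    MulAction.mem_stabilizer_iff.1 (key hk)
  have h4 : k * y ∈ (Y : Set G) * (K : Set G) := by
    rw [← h3]
    exact ⟨y, ⟨y, hy, 1, K.one_mem, by simp⟩, rfl⟩
  obtain ⟨y', hy', k', hk', he⟩ := h4
  exact ⟨y', hy', k', hk', he.symm⟩

theorem IsPSigmaT.of_star [Finite G] (hσ : SigmaPartition σ) (hS : SS σ G) (hT : StarC σ G) :
    IsPSigmaT σ G := by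
  intro H hH K hK
  have r2 : RP σ H ⊤ := hH.rp
  have r1 : RP σ (K.map H.subtype) H := by
    have := (SigmaPermutable.rp hK).map H.subtype
    rwa [← MonoidHom.range_eq_map, Subgroup.range_subtype] at this
  have hKH : K.map H.subtype ≤ H := Subgroup.map_subtype_le K
  obtain ⟨ℋ, hc, -⟩ := hH
  refine ⟨ℋ, hc, fun X hX x => ?_⟩
  generalize K.map H.subtype = K' at *
  by_cases hXb : X = ⊥
  · subst hXb; simp
  obtain ⟨m, hm⟩ := hc.1 X hX hXb
  have hY := IsHallSubgroup.conj hm x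
  generalize X.map (MulAut.conj x).toMonoidHom = Y at *
  let Z := K'.normalCore
  have hZK : Z ≤ K' := K'.normalCore_le
  have hs := QuotientGroup.mk'_surjective Z
  have hker : (⊥ : Subgroup (G ⧸ Z)).comap (QuotientGroup.mk' Z) = Z := by
    rw [MonoidHom.comap_bot, QuotientGroup.ker_mk']
  have hcore : (K'.map (QuotientGroup.mk' Z)).normalCore = ⊥ := by
    rw [eq_bot_iff]
    have h1 : ((K'.map (QuotientGroup.mk' Z)).normalCore).comap (QuotientGroup.mk' Z) ≤ Z := by
      rw [Subgroup.normal_le_normalCore]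
      refine (Subgroup.comap_mono (Subgroup.normalCore_le _)).trans ?_
      rw [Subgroup.comap_map_eq, QuotientGroup.ker_mk']
      exact sup_le le_rfl hZK
    intro b hb
    obtain ⟨g, rfl⟩ := hs b
    exact Subgroup.mem_bot.2 ((QuotientGroup.eq_one_iff g).2 (h1 hb))
  have r2' : RP σ (H.map (QuotientGroup.mk' Z)) ⊤ := by
    have := r2.map (QuotientGroup.mk' Z)
    rwa [Subgroup.map_top_of_surjective _ hs] at this
  have hYb : IsHallSubgroup (σ m) (Y.map (QuotientGroup.mk' Z)) := by
    refine ⟨PrimesIn.of_dvd (S := σ m) hY.1 (Subgroup.card_map_dvd Y _), ?_⟩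
    exact PrimesIn.of_dvd (S := (σ m)ᶜ) hY.2 (Subgroup.index_map_dvd Y hs)
  have hperm := core_free_perm hσ (hS.image _ hs) (hT.image _ hs) hcore (Subgroup.map_mono hKH)
    (r1.map (QuotientGroup.mk' Z)) r2' hYb
  have key : ∀ k ∈ K', ∀ y ∈ Y, ∃ y' ∈ Y, ∃ k' ∈ K', k * y = y' * k' := by
    intro k hk y hy
    obtain ⟨_, ⟨y', hy', rfl⟩, _, ⟨k', hk', rfl⟩, he⟩ := hperm _ ⟨k, hk, rfl⟩ _ ⟨y, hy, rfl⟩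
    rw [← map_mul, ← map_mul] at he
    have h1 : (y' * k')⁻¹ * (k * y) ∈ Z := QuotientGroup.eq.1 he.symm
    exact ⟨y', hy', k' * ((y' * k')⁻¹ * (k * y)), K'.mul_mem hk' (hZK h1), by group⟩
  apply Set.Subset.antisymm
  · rintro _ ⟨k, hk, y, hy, rfl⟩
    obtain ⟨y', hy', k', hk', he⟩ := key k hk y hy
    exact ⟨y', hy', k', hk', he.symm⟩
  · rintro _ ⟨y, hy, k, hk, rfl⟩
    obtain ⟨y', hy', k', hk', he⟩ := key k⁻¹ (K'.inv_mem hk) y⁻¹ (Y.inv_mem hy)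
    refine ⟨k'⁻¹, K'.inv_mem hk', y'⁻¹, Y.inv_mem hy', ?_⟩
    have := congrArg (·⁻¹) he
    simpa using this.symm
end pg

open scoped Pointwise

/-- the hypothesis of the theorem, in working form -/
def Hyp {ι : Type*} (σ : ι → Set ℕ) (G : Type*) [Group G] : Prop :=
  ∀ p : ℕ, p.Prime → p ∣ Nat.card G → ∀ (P : Sylow p G) (V : Subgroup G), V < ↑P →
    (∀ W : Subgroup G, V < W → W ≤ ↑P → W = ↑P) →
    ∃ T : Subgroup G, (∀ g : G, ∃ v ∈ V, ∃ t ∈ T, v * t = g) ∧ SS σ T ∧ StarC σ T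

section ph
variable {ι : Type*} {σ : ι → Set ℕ} {G : Type*} [Group G]

theorem Hyp.image [Finite G] {G' : Type*} [Group G'] (h : Hyp σ G) (f : G →* G')
    (hf : Function.Surjective f) : Hyp σ G' := by
  intro p hp hd P' V' hV' hmax
  haveI := Fact.mk hp
  haveI : Finite G' := Finite.of_surjective f hf
  obtain ⟨P, rfl⟩ := Sylow.mapSurjective_surjective hf p P'
  rw [Sylow.coe_mapSurjective] at hV'
  simp only [Sylow.coe_mapSurjective] at hmax
  obtain ⟨T, h1, h2, h3⟩ := h p hp (hd.trans (Subgroup.card_dvd_of_surjective f hf)) P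
    (↑P ⊓ V'.comap f) (by
      refine lt_of_le_of_ne inf_le_left fun he => hV'.not_ge ?_
      rw [Subgroup.map_le_iff_le_comap]
      rw [← he]; exact inf_le_right) (by
      intro W hW hWP
      have e1 : W.map f = (P : Subgroup G).map f := by
        apply hmax
        · refine lt_of_le_of_ne ?_ ?_
          · intro v hv
            obtain ⟨x, hx, rfl⟩ := hV'.le hv
            exact ⟨x, hW.le ⟨hx, hv⟩, rfl⟩
          · intro he
            refine hW.not_ge (le_inf hWP ?_)
            rw [he]; exact Subgroup.le_comap_map _ _
        · exact Subgroup.map_mono hWP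
      refine le_antisymm hWP fun x hx => ?_
      have : f x ∈ W.map f := by rw [e1]; exact ⟨x, hx, rfl⟩
      obtain ⟨w, hw, hwx⟩ := this
      have h5 : w⁻¹ * x ∈ W := hW.le ⟨(P : Subgroup G).mul_mem (Subgroup.inv_mem _ (hWP hw)) hx, by
        change f (w⁻¹ * x) ∈ V'
        rw [map_mul, map_inv, hwx]; simp⟩
      simpa using W.mul_mem hw h5)
  have hs := f.subgroupMap_surjective T
  refine ⟨T.map f, ?_, h2.image _ hs, h3.image _ hs⟩
  intro g'
  obtain ⟨g, rfl⟩ := hf g'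
  obtain ⟨v, hv, t, ht, rfl⟩ := h1 g
  exact ⟨f v, hv.2, f t, ⟨t, ht, rfl⟩, (map_mul f v t).symm⟩

theorem index_of_supp [Finite G] {q : ℕ} (hq : q.Prime) {V T : Subgroup G} (hV : IsPGroup q V)
    (h : ∀ g : G, ∃ v ∈ V, ∃ t ∈ T, v * t = g) : ∃ n, T.index = q ^ n := by
  haveI := Fact.mk hq
  obtain ⟨n, hn⟩ := hV.card_orbit ((1 : G) : G ⧸ T)
  refine ⟨n, ?_⟩
  rw [← hn]
  have : MulAction.orbit V ((1 : G) : G ⧸ T) = Set.univ := by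
    refine Set.eq_univ_of_forall fun y => ?_
    obtain ⟨g, rfl⟩ := QuotientGroup.mk_surjective y
    obtain ⟨v, hv, t, ht, rfl⟩ := h g
    refine ⟨⟨v, hv⟩, ?_⟩
    change ((v * 1 : G) : G ⧸ T) = _
    rw [QuotientGroup.eq]
    simpa using ht
  rw [this, Nat.card_univ]
  rfl

theorem Hyp.star [Finite G] (h : Hyp σ G) : StarC σ G := by
  intro i M N hM hN hMN hi A hMA hAN q hq hqi x hx a ha
  by_cases hx1 : x = 1
  · subst hx1; simpa using ha
  haveI := Fact.mk hq
  have hqG : q ∣ Nat.card G := by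
    have := hx.dvd_card hq hx1 (Subgroup.mem_top x)
    rwa [Subgroup.card_top] at this
  obtain ⟨Q, hxQ⟩ := hx.zpowers_isPGroup.exists_le_sylow
  have hxQ' : x ∈ (Q : Subgroup G) := hxQ (Subgroup.mem_zpowers x)
  let Q0 : Subgroup G := (Q : Subgroup G) ⊓
    ⨅ A' : {A' : Subgroup G // M ≤ A' ∧ A' ≤ N}, Subgroup.normalizer (A'.1 : Set G)
  by_cases hQ : (Q : Subgroup G) ≤ Q0
  · have h1 := (hQ hxQ').2
    have h2 := Subgroup.mem_iInf.1 h1 ⟨A, hMA, hAN⟩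
    exact (Subgroup.mem_normalizer_iff.1 h2 a).1 ha
  exfalso
  have hlt : Q0 < Q := lt_of_le_not_ge inf_le_left hQ
  obtain ⟨V, hQ0V, hVQ, hVmax⟩ := exists_maximal_between hlt
  obtain ⟨T, hVT, hTS, hTT⟩ := h q hq hqG Q V hVQ hVmax
  have hVp : IsPGroup q V := Q.isPGroup'.to_le hVQ.le
  obtain ⟨n, hn⟩ := index_of_supp hq hVp hVT
  have hNT : N ≤ M ⊔ T := by
    rw [← Subgroup.relIndex_eq_one]
    refine eq_one_of_primesIn (S := σ i) (S' := {q})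
      (hi.of_dvd (Subgroup.relIndex_dvd_of_le_left _ le_sup_left))
      (PrimesIn.of_dvd (primesIn_pow (k := n) hq rfl) ?_)
      (fun p _ h h' => hqi (Set.mem_singleton_iff.1 h' ▸ h))
    have := relIndex_dvd_of_normalizes (U := N) (V := M ⊔ T) le_top le_top
      (fun u hu v _ => hN.conj_mem u hu v)
    rw [Subgroup.relIndex_top_right] at this
    rw [← hn]
    exact this.trans (Subgroup.index_dvd_of_le le_sup_right)
  have hQT : ∀ y ∈ (Q : Subgroup G), y ∈ T → y ∈ Q0 := by
    intro y hyQ hyT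
    refine ⟨hyQ, Subgroup.mem_iInf.2 ?_⟩
    rintro ⟨A', hMA', hAN'⟩
    apply Subgroup.mem_normalizer_fintype
    intro b hb
    change b ∈ A' at hb
    change y * b * y⁻¹ ∈ A'
    have hbMT := hNT (hAN' hb)
    rw [← SetLike.mem_coe, Subgroup.normal_mul] at hbMT
    obtain ⟨m, hm, t, ht, rfl⟩ := hbMT
    change m * t ∈ A' at hb
    change y * (m * t) * y⁻¹ ∈ A'
    have htA : t ∈ A' := by simpa using A'.mul_mem (A'.inv_mem (hMA' hm)) hb
    have h1 := hTT i (M.subgroupOf T) (N.subgroupOf T) inferInstance inferInstance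
      (Subgroup.comap_mono hMN) (by
        unfold Subgroup.subgroupOf
        rw [Subgroup.relIndex_comap]
        exact hi.of_dvd (relIndex_dvd_of_normal (Subgroup.map_comap_le _ _) hM))
      (A'.subgroupOf T) (Subgroup.comap_mono hMA') (Subgroup.comap_mono hAN') q hq hqi ⟨y, hyT⟩
      (PEl.mk (isPGroup_pel Q.isPGroup' hyQ) hyT) ⟨t, ht⟩ htA
    have h2 : y * t * y⁻¹ ∈ A' := h1
    have h3 := A'.mul_mem (hMA' (hM.conj_mem m hm y)) h2
    simpa [mul_assoc] using h3
  apply hVQ.not_ge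
  intro y hy
  obtain ⟨v, hv, t, ht, rfl⟩ := hVT y
  have htQ : t ∈ (Q : Subgroup G) := by
    simpa using (Q : Subgroup G).mul_mem (Subgroup.inv_mem _ (hVQ.le hv)) hy
  exact V.mul_mem hv (hQ0V (hQT t htQ ht))
end ph

open scoped Pointwise

section pi
variable {ι : Type*} {σ : ι → Set ℕ} {G : Type*} [Group G]

/-- no nontrivial normal `σ`-primary subgroups -/
def Rad (σ : ι → Set ℕ) (G : Type*) [Group G] : Prop :=
  ∀ (L : Subgroup G) (i : ι), L.Normal → PrimesIn (σ i) (Nat.card L) → L = ⊥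

theorem Rad.bot_of_le [Finite G] (h : Rad σ G) {A T : Subgroup G} (hA : A.Normal) (hAT : A ≤ T)
    (hT : SS σ T) : A = ⊥ := by
  by_contra hne
  haveI : Nontrivial A := (Subgroup.nontrivial_iff_ne_bot A).2 hne
  have hS : SS σ A := (hT.subgroup (A.subgroupOf T)).image
    (Subgroup.subgroupOfEquivOfLe hAT).toMonoidHom (Subgroup.subgroupOfEquivOfLe hAT).surjective
  obtain ⟨L, hL, hL1, i, hi⟩ := hS.exists_normal
  obtain ⟨F, hF, hFi, hFm⟩ := exists_OS (G := A) (σ i)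
  have h1 : F.map A.subtype = ⊥ := by
    refine h _ i inferInstance ?_
    rwa [Subgroup.card_map_of_injective A.subtype_injective]
  have h2 : F = ⊥ := (Subgroup.map_eq_bot_iff_of_injective F A.subtype_injective).1 h1
  exact hL1 (le_bot_iff.1 (h2 ▸ hFm L hL hi))

theorem not_dvd_pow {p q : ℕ} (hp : p.Prime) (hq : q.Prime) (h : q ≠ p) (n : ℕ) : ¬ q ∣ p ^ n :=
  fun hd => h ((Nat.prime_dvd_prime_iff_eq hq hp).1 (hq.dvd_of_dvd_pow hd))

theorem Rad.bot_of_normalized [Finite G] (h : Rad σ G) (hH : Hyp σ G) {q r : ℕ} (hq : q.Prime)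
    (hqG : q ∣ Nat.card G) (hr : r.Prime) (hrq : r ≠ q) {R : Subgroup G} (hR : IsPGroup r R)
    (Q : Sylow q G) (hQ : ∀ y ∈ (Q : Subgroup G), ∀ a ∈ R, y * a * y⁻¹ ∈ R) : R = ⊥ := by
  haveI := Fact.mk hq
  have hQ1 : (⊥ : Subgroup G) < Q := by
    refine bot_lt_iff_ne_bot.2 fun he => Q.not_dvd_index ?_
    rw [he, Subgroup.index_bot]; exact hqG
  obtain ⟨V, -, hVQ, hVm⟩ := exists_maximal_between hQ1
  obtain ⟨T, hVT, hTS, -⟩ := hH q hq hqG Q V hVQ hVm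
  obtain ⟨n, hn⟩ := index_of_supp hq (Q.isPGroup'.to_le hVQ.le) hVT
  have hRT : R ≤ T := by
    obtain ⟨g, hg⟩ := conj_into_of_not_dvd_index hr hR (H := T) (by
      rw [hn]; exact not_dvd_pow hq hr hrq n)
    obtain ⟨v, hv, t, ht, rfl⟩ := hVT g
    intro x hx
    have h1 := hg _ (hQ v (hVQ.le hv) x hx)
    have h2 := T.mul_mem (T.mul_mem ht h1) (T.inv_mem ht)
    simpa [mul_assoc] using h2
  have h3 : R ≤ T.normalCore := by
    intro x hx g
    obtain ⟨v, hv, t, ht, hg⟩ := hVT g⁻¹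
    have hg' : g = t⁻¹ * v⁻¹ := by rw [← mul_inv_rev, hg, inv_inv]
    have h1 := hRT (hQ v⁻¹ (Subgroup.inv_mem _ (hVQ.le hv)) x hx)
    have h2 := T.mul_mem (T.mul_mem (T.inv_mem ht) h1) ht
    rw [hg']
    simpa [mul_assoc] using h2
  rw [h.bot_of_le inferInstance T.normalCore_le hTS] at h3
  exact le_bot_iff.1 h3

theorem Rad.bot_of_index [Finite G] (h : Rad σ G) (hH : Hyp σ G) {q r : ℕ} (hq : q.Prime)
    (hqG : q ∣ Nat.card G) (hr : r.Prime) (hrq : r ≠ q) {R : Subgroup G} (hR : IsPGroup r R)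
    (hQ : ¬ q ∣ (Subgroup.normalizer (R : Set G)).index) : R = ⊥ := by
  haveI := Fact.mk hq
  obtain ⟨Q⟩ : Nonempty (Sylow q G) := inferInstance
  obtain ⟨g, hg⟩ := conj_into_of_not_dvd_index hq Q.isPGroup' hQ
  refine h.bot_of_normalized hH hq hqG hr hrq hR (g⁻¹ • Q) fun y hy a ha => ?_
  rw [Sylow.coe_subgroup_smul, Subgroup.mem_pointwise_smul_iff_inv_smul_mem] at hy
  have h1 := hg _ hy
  have h2 : y ∈ Subgroup.normalizer (R : Set G) := by
    simpa [MulAut.smul_def, mul_assoc] using h1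
  exact (Subgroup.mem_normalizer_iff.1 h2 a).1 ha

theorem index_dvd_card_of_sup [Finite G] {H L : Subgroup G} (hL : L.Normal) (h : H ⊔ L = ⊤) :
    H.index ∣ Nat.card L := by
  have h1 : L.relIndex H = L.index := by
    rw [← Subgroup.relIndex_sup_right, h, Subgroup.relIndex_top_right]
  have h2 : Nat.card (L ⊓ H : Subgroup G) * L.relIndex H = Nat.card H := by
    rw [← Subgroup.relIndex_bot_left, ← Subgroup.relIndex_bot_left, ← Subgroup.inf_relIndex_right L H]
    exact Subgroup.relIndex_mul_relIndex _ _ _ bot_le inf_le_right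
  have h3 := H.card_mul_index
  rw [← L.card_mul_index, ← h2, h1] at h3
  refine ⟨Nat.card (L ⊓ H : Subgroup G), ?_⟩
  have h4 : 0 < L.index := Nat.pos_of_ne_zero Subgroup.index_ne_zero_of_finite
  apply Nat.eq_of_mul_eq_mul_right h4
  rw [← h3]; ring

theorem map_normalizer_le {T : Subgroup G} (R : Subgroup T) :
    (Subgroup.normalizer (R : Set T)).map T.subtype ≤
      Subgroup.normalizer ((R.map T.subtype : Subgroup G) : Set G) := by
  exact Subgroup.le_normalizer_map T.subtype

theorem Rad.dvd_card [Finite G] (h : Rad σ G) (hH : Hyp σ G) {p q n : ℕ} (hp : p.Prime)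
    (hq : q.Prime) (hpq : q ≠ p) (hqG : q ∣ Nat.card G) {T : Subgroup G} (hT : T.index = p ^ n)
    {L : Subgroup T} (hL : L.Normal) (hL1 : L ≠ ⊥) : q ∣ Nat.card L := by
  by_contra hqL
  have h1 : Nat.card L ≠ 1 := by rwa [Ne, Subgroup.card_eq_one]
  obtain ⟨r, hr, hrL⟩ := Nat.exists_prime_and_dvd h1
  have hrq : r ≠ q := fun e => hqL (e ▸ hrL)
  haveI := Fact.mk hr
  obtain ⟨P⟩ : Nonempty (Sylow r L) := inferInstance
  have hF := Sylow.normalizer_sup_eq_top P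
  have h2 := index_dvd_card_of_sup hL hF
  have h3 : IsPGroup r ((P : Subgroup L).map L.subtype) := P.isPGroup'.map _
  have h4 : ((P : Subgroup L).map L.subtype).map T.subtype = ⊥ := by
    refine h.bot_of_index hH hq hqG hr hrq (h3.map _) fun hd => ?_
    have h5 := hd.trans (Subgroup.index_dvd_of_le (map_normalizer_le _))
    rw [Subgroup.index_map_subtype, hT] at h5
    rcases hq.dvd_mul.1 h5 with h6 | h6
    · exact hqL (h6.trans h2)
    · exact not_dvd_pow hp hq hpq n h6
  rw [Subgroup.map_eq_bot_iff_of_injective _ T.subtype_injective,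
    Subgroup.map_eq_bot_iff_of_injective _ L.subtype_injective] at h4
  apply P.not_dvd_index
  rw [h4, Subgroup.index_bot]; exact hrL

theorem Rad.class [Finite G] (hσ : SigmaPartition σ) [Nontrivial G] (h : Rad σ G) (hH : Hyp σ G)
    {p : ℕ} (hp : p.Prime) (hpG : p ∣ Nat.card G) :
    ∃ i, ∀ q : ℕ, q.Prime → q ∣ Nat.card G → q ≠ p → q ∈ σ i := by
  haveI := Fact.mk hp
  obtain ⟨P⟩ : Nonempty (Sylow p G) := inferInstance
  have hP1 : (⊥ : Subgroup G) < P := by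
    refine bot_lt_iff_ne_bot.2 fun he => P.not_dvd_index ?_
    rw [he, Subgroup.index_bot]; exact hpG
  obtain ⟨V, -, hVQ, hVm⟩ := exists_maximal_between hP1
  obtain ⟨T, hVT, hTS, -⟩ := hH p hp hpG P V hVQ hVm
  obtain ⟨n, hn⟩ := index_of_supp hp (P.isPGroup'.to_le hVQ.le) hVT
  have hT : T ≠ ⊥ := by
    rintro rfl
    rw [Subgroup.index_bot] at hn
    obtain ⟨i, hi⟩ := sp_ex hσ hp
    refine bot_ne_top (h ⊤ i inferInstance ?_).symm
    rw [Subgroup.card_top, hn]; exact primesIn_pow hp hi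
  haveI : Nontrivial T := (Subgroup.nontrivial_iff_ne_bot T).2 hT
  obtain ⟨L, hL, hL1, i, hi⟩ := hTS.exists_normal
  exact ⟨i, fun q hq hqG hqp => hi q hq (h.dvd_card hH hp hq hqp hqG hn hL hL1)⟩

theorem Rad.two [Finite G] (hσ : SigmaPartition σ) [Nontrivial G] (h : Rad σ G) (hH : Hyp σ G) :
    ∃ (p q : ℕ) (i j : ι), p.Prime ∧ q.Prime ∧ i ≠ j ∧ p ∈ σ i ∧ q ∈ σ j ∧ p ∣ Nat.card G ∧
      q ∣ Nat.card G ∧ ∀ r : ℕ, r.Prime → r ∣ Nat.card G → r = p ∨ r = q := by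
  obtain ⟨p, hp, hpG⟩ := Nat.exists_prime_and_dvd (Finite.one_lt_card (α := G)).ne'
  obtain ⟨j, hj⟩ := h.class hσ hH hp hpG
  obtain ⟨i, hi⟩ := sp_ex hσ hp
  have hq : ∃ q : ℕ, q.Prime ∧ q ∣ Nat.card G ∧ q ∉ σ i := by
    by_contra hcon
    push Not at hcon
    exact bot_ne_top (h ⊤ i inferInstance (by rw [Subgroup.card_top]; exact hcon)).symm
  obtain ⟨q, hq, hqG, hqi⟩ := hq
  have hqp : q ≠ p := fun e => hqi (e ▸ hi)
  have hqj := hj q hq hqG hqp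
  have hij : i ≠ j := fun e => hqi (e ▸ hqj)
  refine ⟨p, q, i, j, hp, hq, hij, hi, hqj, hpG, hqG, fun r hr hrG => ?_⟩
  by_contra hcon
  push Not at hcon
  obtain ⟨k, hk⟩ := h.class hσ hH hq hqG
  have e1 := sp_eq hσ hi (hk p hp hpG hqp.symm)
  have e2 := sp_eq hσ (hk r hr hrG hcon.2) (hj r hr hrG hcon.1)
  exact hij (e1.trans e2)

theorem top_le_normalizer [Finite G] {p q : ℕ} (hp : p.Prime) (hq : q.Prime)
    (hpq : ∀ r : ℕ, r.Prime → r ∣ Nat.card G → r = p ∨ r = q) (Q : Sylow q G) {P : Subgroup G}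
    (hP : ¬ p ∣ P.index) (hPQ : P ≤ Subgroup.normalizer ((Q : Subgroup G) : Set G)) :
    (Q : Subgroup G).Normal := by
  haveI := Fact.mk hq
  rw [← Subgroup.normalizer_eq_top_iff, ← Subgroup.index_eq_one]
  by_contra hne
  obtain ⟨r, hr, hrd⟩ := Nat.exists_prime_and_dvd hne
  rcases hpq r hr (hrd.trans (Subgroup.index_dvd_card _)) with rfl | rfl
  · exact hP (hrd.trans (Subgroup.index_dvd_of_le hPQ))
  · exact Q.not_dvd_index (hrd.trans (Subgroup.index_dvd_of_le Subgroup.le_normalizer))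

/-- in a group without normal `p`-subgroups the Sylow `q`-subgroup is normal -/
theorem sylow_normal_of_star [Finite G] (hσ : SigmaPartition σ) (hS : SS σ G) (hT : StarC σ G)
    {p q : ℕ} {i j : ι} (hij : i ≠ j) (hp : p.Prime) (hq : q.Prime) (hpi : p ∈ σ i) (hqj : q ∈ σ j)
    (hpq : ∀ r : ℕ, r.Prime → r ∣ Nat.card G → r = p ∨ r = q)
    (hN : ∀ N : Subgroup G, N.Normal → IsPGroup p N → N = ⊥) (S : Sylow q G) :
    (S : Subgroup G).Normal := by
  haveI := Fact.mk hp
  haveI := Fact.mk hq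
  obtain ⟨P⟩ : Nonempty (Sylow p G) := inferInstance
  refine top_le_normalizer hp hq hpq S (P := P) P.not_dvd_index fun a ha => ?_
  apply Subgroup.mem_normalizer_fintype
  intro b hb
  have ha' : PEl p a := isPGroup_pel P.isPGroup' ha
  have hb' : PEl q b := isPGroup_pel S.isPGroup' hb
  have hn := lemmaE' hσ hS hT hij hp hq hpi hqj ha' hb'
  have hC : IsPGroup q (Subgroup.zpowers (a * b * a⁻¹ * b⁻¹)) := by
    have hc : PrimesIn {q} (Nat.card (Subgroup.zpowers (a * b * a⁻¹ * b⁻¹))) := by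
      intro r hr hrd
      rcases hpq r hr (hrd.trans (Subgroup.card_subgroup_dvd_card _)) with rfl | rfl
      · exfalso
        obtain ⟨e, he, hre, he1⟩ := exists_pel_of_dvd hr hrd
        have h1 := lemmaE hσ hS hT hij hp hq hpi hqj ha' hb' he hr hre
        have h2 := hN _ h1 hre.zpowers_isPGroup
        exact he1 (Subgroup.zpowers_eq_bot.1 h2)
      · rfl
    rw [IsPGroup.iff_card]
    exact ⟨_, Nat.eq_prime_pow_of_unique_prime_dvd Nat.card_pos.ne' fun hr hrd => hc _ hr hrd⟩
  obtain ⟨S', hS'⟩ := hC.exists_le_sylow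
  have hCS : a * b * a⁻¹ * b⁻¹ ∈ (S : Subgroup G) := by
    obtain ⟨g, hg⟩ := MulAction.exists_smul_eq G S' S
    have h1 : g * (g⁻¹ * (a * b * a⁻¹ * b⁻¹) * g) * g⁻¹ ∈ (S : Subgroup G) := by
      have h2 := hS' (by simpa using hn.conj_mem _ (Subgroup.mem_zpowers _) g⁻¹ :
        g⁻¹ * (a * b * a⁻¹ * b⁻¹) * g ∈ _)
      rw [← hg, Sylow.coe_subgroup_smul, Subgroup.mem_pointwise_smul_iff_inv_smul_mem]
      simpa [MulAut.smul_def, mul_assoc] using h2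
    simpa [mul_assoc] using h1
  have h5 := (S : Subgroup G).mul_mem hCS hb
  rw [inv_mul_cancel_right] at h5
  exact h5

theorem Rad.false [Finite G] (hσ : SigmaPartition σ) [Nontrivial G] (h : Rad σ G) (hH : Hyp σ G) :
    False := by
  obtain ⟨p, q, i, j, hp, hq, hij, hpi, hqj, hpG, hqG, hpq⟩ := h.two hσ hH
  have hne : p ≠ q := fun e => hij (sp_eq hσ hpi (e ▸ hqj))
  haveI := Fact.mk hp
  haveI := Fact.mk hq
  obtain ⟨P⟩ : Nonempty (Sylow p G) := inferInstance
  obtain ⟨Q⟩ : Nonempty (Sylow q G) := inferInstance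
  set N0 := Subgroup.normalizer ((Q : Subgroup G) : Set G) with hN0
  by_cases hP : (P : Subgroup G) ≤ N0
  · have h1 := top_le_normalizer hp hq hpq Q P.not_dvd_index hP
    have h2 := h _ j h1 (isPGroup_primesIn hq Q.isPGroup' hqj)
    apply Q.not_dvd_index
    rw [h2, Subgroup.index_bot]; exact hqG
  have hlt : (P : Subgroup G) ⊓ N0 < P :=
    lt_of_le_not_ge inf_le_left fun hle => hP (hle.trans inf_le_right)
  obtain ⟨V, hPV, hVP, hVm⟩ := exists_maximal_between hlt
  obtain ⟨T, hVT, hTS, hTT⟩ := hH p hp hpG P V hVP hVm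
  obtain ⟨n, hn⟩ := index_of_supp hp (P.isPGroup'.to_le hVP.le) hVT
  have hqT : ¬ q ∣ T.index := by rw [hn]; exact not_dvd_pow hp hq hne.symm n
  obtain ⟨S⟩ : Nonempty (Sylow q T) := inferInstance
  have hSn : (S : Subgroup T).Normal := by
    refine sylow_normal_of_star hσ hTS hTT hij hp hq hpi hqj
      (fun r hr hrd => hpq r hr (hrd.trans (Subgroup.card_subgroup_dvd_card T))) ?_ S
    intro N hN hNp
    have h1 : N.map T.subtype = ⊥ := by
      refine h.bot_of_index hH hq hqG hp hne (hNp.map _) fun hd => hqT ?_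
      refine hd.trans (Subgroup.index_dvd_of_le ?_)
      have h2 := map_normalizer_le N
      rw [Subgroup.normalizer_eq_top_iff.2 hN] at h2
      simpa [← MonoidHom.range_eq_map] using h2
    exact (Subgroup.map_eq_bot_iff_of_injective _ T.subtype_injective).1 h1
  have hSi : ¬ q ∣ ((S : Subgroup T).map T.subtype).index := by
    rw [Subgroup.index_map_subtype]
    intro hd
    rcases hq.dvd_mul.1 hd with h1 | h1
    · exact S.not_dvd_index h1
    · exact hqT h1
  obtain ⟨g, hg⟩ := conj_into_of_not_dvd_index hq Q.isPGroup' hSi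
  -- `g S g⁻¹ = Q`
  have hgS : ((S : Subgroup T).map T.subtype).map (MulAut.conj g).toMonoidHom = Q := by
    refine Q.is_maximal' ((S.isPGroup'.map _).map _) fun x hx => ?_
    exact ⟨_, hg x hx, by simp [mul_assoc]⟩
  have hTN : ∀ t ∈ T, g * t * g⁻¹ ∈ N0 := by
    intro t ht
    apply Subgroup.mem_normalizer_fintype
    intro x hx
    change x ∈ (Q : Subgroup G) at hx
    change _ ∈ (Q : Subgroup G)
    rw [← hgS] at hx ⊢
    obtain ⟨_, ⟨s, hs, rfl⟩, rfl⟩ := hx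
    refine ⟨_, ⟨_, hSn.conj_mem s hs ⟨t, ht⟩, rfl⟩, ?_⟩
    simp [mul_assoc]
  obtain ⟨v, hv, t, ht, rfl⟩ := hVT g
  have hTN' : ∀ u ∈ T, v * u * v⁻¹ ∈ N0 := by
    intro u hu
    have := hTN (t⁻¹ * u * t) (T.mul_mem (T.mul_mem (T.inv_mem ht) hu) ht)
    simpa [mul_assoc] using this
  refine hVP.not_ge fun y hy => ?_
  obtain ⟨v1, hv1, t1, ht1, he⟩ := hVT (y * v)
  have hy' : y = v1 * v⁻¹ * (v * t1 * v⁻¹) := by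
    have h3 : y = v1 * t1 * v⁻¹ := by rw [he]; simp
    rw [h3]; group
  have h1 : v1 * v⁻¹ ∈ V := V.mul_mem hv1 (V.inv_mem hv)
  have h2 : v * t1 * v⁻¹ ∈ (P : Subgroup G) := by
    have h3 : v * t1 * v⁻¹ = (v1 * v⁻¹)⁻¹ * y := by rw [hy']; group
    rw [h3]
    exact Subgroup.mul_mem _ (Subgroup.inv_mem _ (hVP.le h1)) hy
  rw [hy']
  exact V.mul_mem h1 (hPV ⟨h2, hTN' t1 ht1⟩)

theorem Hyp.ss_aux (hσ : SigmaPartition σ) (n : ℕ) :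
    ∀ (G : Type*) [Group G] [Finite G], Nat.card G = n → Hyp σ G → SS σ G := by
  induction n using Nat.strong_induction_on with
  | _ n ih =>
    intro G _ _ hn hH
    by_contra hS
    haveI : Nontrivial G := by
      by_contra hnt
      rw [not_nontrivial_iff_subsingleton] at hnt
      exact hS fun M _ hM => absurd (Subsingleton.elim M ⊤) hM
    refine Rad.false hσ (G := G) (fun L i hL hi => ?_) hH
    by_contra hL1
    refine hS (SS.extension hi (ih (Nat.card (G ⧸ L)) ?_ _ rfl
      (hH.image (QuotientGroup.mk' L) (QuotientGroup.mk'_surjective L))))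
    rw [← hn, Subgroup.card_eq_card_quotient_mul_card_subgroup L]
    have h1 : 1 < Nat.card L := by
      haveI : Nontrivial L := (Subgroup.nontrivial_iff_ne_bot L).2 hL1
      exact Finite.one_lt_card
    exact lt_mul_of_one_lt_right Nat.card_pos h1

theorem Hyp.ss [Finite G] (hσ : SigmaPartition σ) (hH : Hyp σ G) : SS σ G :=
  Hyp.ss_aux hσ _ G rfl hH
end pi

/-- **Theorem A(iii).** If every maximal subgroup of every Sylow subgroup of a finite
group `G` has a supplement in `G` that is a `σ`-soluble `PσT`-group, then `G` is a
`σ`-soluble `PσT`-group. -/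
theorem sigma_soluble_PsigmaT_of_supplements {ι : Type*} (σ : ι → Set ℕ)
    (hσ : SigmaPartition σ) (G : Type*) [Group G] [Finite G]
    (hsupp : ∀ p : ℕ, p.Prime → p ∣ Nat.card G →
      ∀ (P : Sylow p G) (V : Subgroup G), V < ↑P →
        (∀ W : Subgroup G, V < W → W ≤ ↑P → W = ↑P) →
        ∃ T : Subgroup G, (V : Set G) * (T : Set G) = Set.univ ∧
          SigmaSoluble σ ↥T ∧ IsPSigmaT σ ↥T) :
    SigmaSoluble σ G ∧ IsPSigmaT σ G := by
  have hH : Hyp σ G := by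
    intro p hp hpG P V hV hm
    obtain ⟨T, h1, h2, h3⟩ := hsupp p hp hpG P V hV hm
    refine ⟨T, fun g => ?_, h2.ss, h3.star hσ h2.ss⟩
    have hg : g ∈ (V : Set G) * (T : Set G) := by rw [h1]; trivial
    exact Set.mem_mul.1 hg
  have hS := hH.ss hσ
  exact ⟨hS.sigmaSoluble, IsPSigmaT.of_star hσ hS hH.star⟩
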